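/- arXiv:2212.09893 — 11 statements merged into one kernel-verified Lean document; each statement's English description precedes it below -/
import Mathlib

section
/- Let X be an arc-like continuum and let p, q ∈ X with p ≠ q. Then every subcontinuum K of X² = X × X that contains both points (p,q) and (q,p) intersects the diagonal Δ = {(x,x) : x ∈ X}. -/
open Set

/-- An `ε`-map is a continuous surjection whose point-preimages all have diameter
less than `ε`. -/
def IsEpsilonMap {X Y : Type*} [MetricSpace X] [TopologicalSpace Y]
    (ε : ℝ) (g : X → Y) : Prop :=
  Continuous g ∧ Function.Surjective g ∧ ∀ y : Y, Metric.diam (g ⁻¹' {y}) < ε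

/-- A metric space is arc-like if for every `ε > 0` there is an `ε`-map onto `[0,1]`. -/
def ArcLike (X : Type*) [MetricSpace X] : Prop :=
  ∀ ε : ℝ, 0 < ε → ∃ g : X → Set.Icc (0:ℝ) 1, IsEpsilonMap ε g

/-- Let `X` be an arc-like continuum and `p ≠ q` points of `X`.  Every subcontinuum of
`X × X` containing both `(p, q)` and `(q, p)` meets the diagonal. -/
theorem arcLike_subcontinuum_meets_diagonal
    {X : Type*} [MetricSpace X] [CompactSpace X] [ConnectedSpace X] [Nontrivial X]
    (hX : ArcLike X) (p q : X) (hpq : p ≠ q)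
    (K : Set (X × X)) (hKcomp : IsCompact K) (hKconn : IsConnected K)
    (hpqmem : (p, q) ∈ K) (hqpmem : (q, p) ∈ K) :
    (K ∩ {z : X × X | z.1 = z.2}).Nonempty := by
  by_contra hne
  obtain ⟨z0, hz0, hmin⟩ := hKcomp.exists_isMinOn hKconn.nonempty
    (f := fun z : X × X => dist z.1 z.2) (by fun_prop)
  have hpos : 0 < dist z0.1 z0.2 := by
    rw [dist_pos]
    intro h
    exact hne ⟨z0, hz0, h⟩
  obtain ⟨g, hgc, -, hgd⟩ := hX _ hpos
  have hcont : Continuous (fun z : X × X => ((g z.1 : ℝ) - (g z.2 : ℝ))) := by fun_prop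
  have hz : ∃ z ∈ K, (g z.1 : ℝ) - (g z.2 : ℝ) = 0 := by
    rcases le_total (g p : ℝ) (g q : ℝ) with h | h
    · exact hKconn.isPreconnected.intermediate_value hpqmem hqpmem hcont.continuousOn
        ⟨by simpa using h, by simpa using h⟩
    · exact hKconn.isPreconnected.intermediate_value hqpmem hpqmem hcont.continuousOn
        ⟨by simpa using h, by simpa using h⟩
  obtain ⟨z, hzK, hz⟩ := hz
  have heq : g z.1 = g z.2 := Subtype.ext (sub_eq_zero.mp hz)
  have h1 : dist z.1 z.2 ≤ Metric.diam (g ⁻¹' {g z.2}) :=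
    Metric.dist_le_diam_of_mem (Metric.isBounded_of_compactSpace) (by simp [heq]) (by simp)
  have h2 : dist z0.1 z0.2 ≤ dist z.1 z.2 := hmin hzK
  linarith [hgd (g z.2)]
end

section
/- Let X be an arc-like continuum. Then X² \ Δ is not continuumwise connected in X²; that is, there exist points p, q ∈ X² \ Δ for which no subcontinuum M of X² satisfies {p,q} ⊆ M ⊆ X² \ Δ. -/
open Set

/-- A subset `R` of a space `Y` is continuumwise connected if any two of its points lie in
a subcontinuum of `Y` (a nonempty compact connected subset) contained in `R`. -/
def ContinuumwiseConnected {Y : Type*} [TopologicalSpace Y] (R : Set Y) : Prop :=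
  ∀ p ∈ R, ∀ q ∈ R, ∃ M : Set Y, IsCompact M ∧ IsConnected M ∧ p ∈ M ∧ q ∈ M ∧ M ⊆ R

/-- If `X` is an arc-like continuum, then `X² \ Δ` is not continuumwise connected:
there are points `p, q ∈ X² \ Δ` joined by no subcontinuum of `X²` missing the diagonal. -/
theorem arcLike_compl_diagonal_not_continuumwiseConnected
    {X : Type*} [MetricSpace X] [CompactSpace X] [ConnectedSpace X] [Nontrivial X]
    (hX : ArcLike X) :
    ¬ ContinuumwiseConnected {z : X × X | z.1 ≠ z.2} := by
  obtain ⟨a, b, hab⟩ := exists_pair_ne X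
  intro h
  obtain ⟨M, hMc, hMconn, hp, hq, hMR⟩ := h (a, b) hab (b, a) hab.symm
  obtain ⟨z, hz, hmin⟩ := hMc.exists_isMinOn ⟨_, hp⟩
    (f := fun z : X × X => dist z.1 z.2) (by fun_prop)
  obtain ⟨g, hg, -, hdiam⟩ := hX (dist z.1 z.2) (dist_pos.mpr (hMR hz))
  have hc : ContinuousOn (fun z : X × X => (g z.1 : ℝ) - g z.2) M := by fun_prop
  have key : ∃ w ∈ M, (g w.1 : ℝ) - g w.2 = 0 := by
    rcases le_total (g a : ℝ) (g b) with hle | hle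
    · exact hMconn.isPreconnected.intermediate_value hp hq hc
        ⟨sub_nonpos.mpr hle, sub_nonneg.mpr hle⟩
    · exact hMconn.isPreconnected.intermediate_value hq hp hc
        ⟨sub_nonpos.mpr hle, sub_nonneg.mpr hle⟩
  obtain ⟨w, hw, hw0⟩ := key
  have he : g w.1 = g w.2 := Subtype.ext (sub_eq_zero.mp hw0)
  have h1 : dist z.1 z.2 ≤ dist w.1 w.2 := hmin hw
  have h2 : dist w.1 w.2 ≤ Metric.diam (g ⁻¹' {g w.2}) :=
    Metric.dist_le_diam_of_mem (Metric.isBounded_of_compactSpace) he rfl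
  exact absurd (hdiam (g w.2)) (not_lt.mpr (h1.trans h2))
end

section
/- Let f : C → C be a homeomorphism of the Cantor ternary set such that every orbit of f is dense in C, every orbit of f⁻¹ is dense in C, and f × f : C² → C² has a dense orbit. Let X be the quotient space obtained from C × [0,1] by identifying, for each p ∈ C, the point (p,1) with (f(p),0). Then X is an indecomposable continuum (X is compact, connected, metrizable, has more than one point, and is not the union of two proper subcontinua), the diagonal Δ = {(x,x) : x ∈ X} has empty interior in X², and Δ is colocally connected in X²: for each open subset U of X² with Δ ⊆ U there exists an open subset V of X² such that Δ ⊆ V ⊆ U and X² \ V is connected. -/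
open Set

noncomputable section

/-- The Cantor ternary set, as a topological (metric) space. -/
abbrev CantorT : Type := ↥cantorSet

/-- The unit interval `[0,1]` as a subspace of `ℝ`. -/
abbrev UnitI : Type := ↥(Set.Icc (0:ℝ) 1)

/-- The product `C × [0,1]`. -/
abbrev CI : Type := CantorT × UnitI

/-- The identification relation on `C × [0,1]`: the point `(p,1)` is glued to `(f p, 0)`. -/
def glueRel (f : CantorT → CantorT) (a b : CI) : Prop :=
  (a.2 : ℝ) = 1 ∧ b.1 = f a.1 ∧ (b.2 : ℝ) = 0

/-- The quotient space `X` obtained from `C × [0,1]` by identifying `(p,1)` with `(f p, 0)`,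
with the quotient topology. -/
abbrev GlueSpace (f : CantorT → CantorT) : Type := Quot (glueRel f)

open Topology

instance instCompactCantorT : CompactSpace CantorT :=
  isCompact_iff_compactSpace.mp isCompact_cantorSet

instance instTDCantorT : TotallyDisconnectedSpace CantorT :=
  cantorSetHomeomorphNatToBool.symm.totallyDisconnectedSpace

instance instInfCantorT : Infinite CantorT :=
  cantorSetEquivNatToBool.infinite_iff.mpr inferInstance

/-- The covering map `C × ℝ → X`. -/
def gpi (f : CantorT ≃ₜ CantorT) (a : CantorT × ℝ) : GlueSpace ⇑f :=
  Quot.mk _ ((f ^ ⌊a.2⌋) a.1, ⟨Int.fract a.2, Int.fract_nonneg _, (Int.fract_lt_one _).le⟩)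

theorem gpi_shift (f : CantorT ≃ₜ CantorT) (p : CantorT) (t : ℝ) (k : ℤ) :
    gpi f (p, t + k) = gpi f ((f ^ k) p, t) := by
  unfold gpi
  simp only [Int.fract_add_intCast, Int.floor_add_intCast, zpow_add]
  rfl

theorem gpi_shift' (f : CantorT ≃ₜ CantorT) (p : CantorT) (t : ℝ) (k : ℤ) :
    gpi f (p, t) = gpi f ((f ^ k) p, t - k) := by
  rw [← gpi_shift, sub_add_cancel]

theorem gpi_mk (f : CantorT ≃ₜ CantorT) (p : CantorT) (s : UnitI) :
    (Quot.mk _ (p, s) : GlueSpace ⇑f) = gpi f (p, (s : ℝ)) := by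
  obtain ⟨s, h0, h1⟩ := s
  rcases h1.lt_or_eq with h | h
  · have h2 : ⌊s⌋ = 0 := Int.floor_eq_zero_iff.mpr ⟨h0, h⟩
    have h3 : Int.fract s = s := Int.fract_eq_self.mpr ⟨h0, h⟩
    simp only [gpi, h2, h3, zpow_zero]
    rfl
  · subst h
    unfold gpi
    apply Quot.sound
    refine ⟨rfl, ?_, ?_⟩ <;> simp

theorem gpi_surj (f : CantorT ≃ₜ CantorT) : Function.Surjective (gpi f) := by
  intro x
  induction x using Quot.ind with
  | mk a => exact ⟨_, (gpi_mk f a.1 a.2).symm⟩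

/-- The orbit relation. -/
def gset (f : CantorT ≃ₜ CantorT) : Setoid (CantorT × ℝ) where
  r a b := ∃ k : ℤ, a.2 = b.2 + k ∧ b.1 = (f ^ k) a.1
  iseqv := by
    refine ⟨fun a => ⟨0, by simp⟩, ?_, ?_⟩
    · rintro a b ⟨k, h1, h2⟩
      refine ⟨-k, by push_cast; linarith, ?_⟩
      rw [h2, ← Homeomorph.mul_apply, ← zpow_add]
      simp
    · rintro a b c ⟨k, h1, h2⟩ ⟨l, h3, h4⟩
      refine ⟨l + k, by push_cast; linarith, ?_⟩
      rw [h4, h2, ← Homeomorph.mul_apply, ← zpow_add]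

theorem gpi_eq (f : CantorT ≃ₜ CantorT) {a b : CantorT × ℝ} (h : gpi f a = gpi f b) :
    ∃ k : ℤ, a.2 = b.2 + k ∧ b.1 = (f ^ k) a.1 := by
  let g : GlueSpace ⇑f → Quotient (gset f) :=
    Quot.lift (fun a => Quotient.mk (gset f) (a.1, (a.2 : ℝ))) (by
      rintro a b ⟨h1, h2, h3⟩
      apply Quotient.sound
      exact ⟨1, by simp [h1, h3], by simp [h2]⟩)
  have key : ∀ a, g (gpi f a) = Quotient.mk (gset f) a := by
    intro a
    apply Quotient.sound
    refine ⟨-⌊a.2⌋, ?_, ?_⟩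
    · simp only [Int.fract]; push_cast; ring
    · dsimp only
      rw [← Homeomorph.mul_apply, ← zpow_add]
      simp
  have h2 : Quotient.mk (gset f) a = Quotient.mk (gset f) b := by rw [← key, ← key, h]
  exact Quotient.exact h2

theorem continuous_gpi (f : CantorT ≃ₜ CantorT) : Continuous (gpi f) := by
  have hlf : LocallyFinite (fun k : ℤ => (Prod.snd : CantorT × ℝ → ℝ) ⁻¹' Icc (k : ℝ) (k + 1)) :=
    LocallyFinite.preimage_continuous (by
      intro x
      refine ⟨Ioo (x - 1) (x + 1), Ioo_mem_nhds (by linarith) (by linarith), ?_⟩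
      apply (Set.finite_Icc (⌊x⌋ - 3) (⌊x⌋ + 3)).subset
      rintro k ⟨y, ⟨h1, h2⟩, h3, h4⟩
      have h5 := Int.floor_le x
      have h6 := Int.lt_floor_add_one x
      constructor
      · have : ((⌊x⌋ : ℤ) : ℝ) < ((k + 3 : ℤ) : ℝ) := by push_cast; linarith
        have := Int.cast_lt.mp this
        omega
      · have : (k : ℝ) < ((⌊x⌋ + 3 : ℤ) : ℝ) := by push_cast; linarith
        have := Int.cast_lt.mp this
        omega) continuous_snd
  refine hlf.continuous ?_ (fun k => isClosed_Icc.preimage continuous_snd) ?_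
  · rw [eq_univ_iff_forall]
    intro x
    rw [mem_iUnion]
    exact ⟨⌊x.2⌋, Int.floor_le _, (Int.lt_floor_add_one _).le⟩
  · intro k
    have hc : Continuous (fun a : CantorT × ℝ =>
        (Quot.mk _ ((f ^ k) a.1, Set.projIcc (0:ℝ) 1 zero_le_one (a.2 - k)) : GlueSpace ⇑f)) := by
      refine continuous_quot_mk.comp ?_
      refine Continuous.prodMk ((f ^ k).continuous.comp continuous_fst) ?_
      exact continuous_projIcc.comp (by fun_prop)
    refine hc.continuousOn.congr ?_
    rintro ⟨p, t⟩ ⟨h1, h2⟩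
    dsimp only at h1 h2 ⊢
    rw [gpi_mk, gpi_shift' f p t k, Set.projIcc_of_mem zero_le_one ⟨by linarith, by linarith⟩]

theorem isOpenMap_gpi (f : CantorT ≃ₜ CantorT) : IsOpenMap (gpi f) := by
  intro U hU
  rw [← isQuotientMap_quot_mk.isOpen_preimage]
  have : (Quot.mk (glueRel ⇑f)) ⁻¹' (gpi f '' U) =
      ⋃ k : ℤ, (fun a : CI => ((f ^ k) a.1, (a.2 : ℝ) - k)) ⁻¹' U := by
    ext ⟨p, s⟩
    simp only [mem_preimage, mem_iUnion, mem_image]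
    constructor
    · rintro ⟨b, hb, h⟩
      rw [gpi_mk] at h
      obtain ⟨k, h1, h2⟩ := gpi_eq f h.symm
      refine ⟨k, ?_⟩
      dsimp only at h1 h2
      rw [← h2, h1, add_sub_cancel_right]
      exact hb
    · rintro ⟨k, hk⟩
      refine ⟨_, hk, ?_⟩
      rw [gpi_mk, ← gpi_shift']
  rw [this]
  refine isOpen_iUnion fun k => hU.preimage ?_
  exact ((f ^ k).continuous.comp continuous_fst).prodMk (by fun_prop)

theorem isOpenQuotientMap_gpi (f : CantorT ≃ₜ CantorT) : IsOpenQuotientMap (gpi f) :=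
  ⟨gpi_surj f, continuous_gpi f, isOpenMap_gpi f⟩

instance instT2Glue (f : CantorT ≃ₜ CantorT) : T2Space (GlueSpace ⇑f) := by
  rw [t2Space_iff_of_isOpenQuotientMap (isOpenQuotientMap_gpi f)]
  have : {q : (CantorT × ℝ) × (CantorT × ℝ) | gpi f q.1 = gpi f q.2} =
      ⋃ k : ℤ, {q | q.1.2 - q.2.2 = (k : ℝ) ∧ q.2.1 = (f ^ k) q.1.1} := by
    ext ⟨a, b⟩
    simp only [mem_ofPred_eq, mem_iUnion]
    constructor
    · intro h
      obtain ⟨k, h1, h2⟩ := gpi_eq f h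
      exact ⟨k, by linarith, h2⟩
    · rintro ⟨k, h1, h2⟩
      rw [show a = (a.1, b.2 + k) from Prod.ext rfl (by dsimp only; linarith), gpi_shift, ← h2]
  rw [this]
  have hlf : LocallyFinite (fun k : ℤ => ({(k : ℝ)} : Set ℝ)) := by
    intro x
    refine ⟨Ioo (x - 1) (x + 1), Ioo_mem_nhds (by linarith) (by linarith), ?_⟩
    apply (Set.finite_Icc (⌊x⌋ - 3) (⌊x⌋ + 3)).subset
    rintro k ⟨y, rfl, h3, h4⟩
    have h5 := Int.floor_le x
    have h6 := Int.lt_floor_add_one x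
    constructor
    · have : ((⌊x⌋ : ℤ) : ℝ) < ((k + 3 : ℤ) : ℝ) := by push_cast; linarith
      have := Int.cast_lt.mp this
      omega
    · have : (k : ℝ) < ((⌊x⌋ + 3 : ℤ) : ℝ) := by push_cast; linarith
      have := Int.cast_lt.mp this
      omega
  have hlf2 := hlf.preimage_continuous
    (g := fun q : (CantorT × ℝ) × (CantorT × ℝ) => q.1.2 - q.2.2) (by fun_prop)
  refine LocallyFinite.isClosed_iUnion (hlf2.subset ?_) ?_
  · rintro k q ⟨h1, h2⟩
    exact h1
  · intro k
    refine IsClosed.inter (isClosed_eq (by fun_prop) (by fun_prop)) ?_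
    exact isClosed_eq (by fun_prop) ((f ^ k).continuous.comp (by fun_prop))

instance instSCGlue (f : CantorT ≃ₜ CantorT) : SecondCountableTopology (GlueSpace ⇑f) :=
  (isOpenQuotientMap_gpi f).isQuotientMap.secondCountableTopology (isOpenMap_gpi f)

theorem iter_eq (f : CantorT ≃ₜ CantorT) (n : ℕ) (x : CantorT) :
    (⇑f)^[n] x = (f ^ (n : ℤ)) x := by
  induction n generalizing x with
  | zero => rfl
  | succ n ih =>
    rw [Function.iterate_succ_apply, ih]
    push_cast
    rw [zpow_add, zpow_one]; rfl

theorem iter_symm_eq (f : CantorT ≃ₜ CantorT) (n : ℕ) (x : CantorT) :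
    (⇑f.symm)^[n] x = (f ^ (-(n : ℤ))) x := by
  rw [iter_eq, zpow_neg, ← inv_zpow]; rfl

theorem infinite_of_open (f : CantorT ≃ₜ CantorT)
    (hmin : ∀ x : CantorT, Dense (Set.range fun n : ℕ => (⇑f)^[n] x))
    (S : Set CantorT) (hS : IsOpen S) (hne : S.Nonempty) : S.Infinite := by
  intro hfin
  obtain ⟨x, hx⟩ := hne
  have hxo : IsOpen ({x} : Set CantorT) := by
    have h1 : IsOpen (S \ (S \ {x})) := hS.sdiff (hfin.subset sdiff_subset).isClosed
    have h2 : S \ (S \ {x}) = {x} := by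
      ext y; simp only [mem_sdiff, mem_singleton_iff, not_and, not_not]
      constructor
      · rintro ⟨h, h'⟩; exact h' h
      · rintro rfl; exact ⟨hx, fun _ => rfl⟩
    rwa [h2] at h1
  have hd : DiscreteTopology CantorT := by
    rw [discreteTopology_iff_isOpen_singleton]
    intro y
    obtain ⟨z, ⟨n, hn⟩, hz⟩ := (hmin y).exists_mem_open hxo ⟨x, rfl⟩
    dsimp only at hn
    rw [mem_singleton_iff] at hz; subst hz
    have h3 := hxo.preimage (f ^ (n : ℤ)).continuous
    convert h3 using 1
    ext w
    simp only [mem_singleton_iff, mem_preimage]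
    rw [iter_eq] at hn
    constructor
    · rintro rfl; exact hn
    · rintro h; exact (f ^ (n : ℤ)).injective (h.trans hn.symm)
  exact not_finite_iff_infinite.mpr instInfCantorT finite_of_compact_of_discrete

theorem plane_dense (f : CantorT ≃ₜ CantorT) (z : CantorT × CantorT)
    (hz : Dense (Set.range fun n : ℕ => (Prod.map ⇑f ⇑f)^[n] z)) :
    DenseRange (fun w : ℝ × ℝ => (gpi f (z.1, w.1), gpi f (z.2, w.1 + w.2))) := by
  unfold DenseRange
  rw [dense_iff_inter_open]
  rintro O hO ⟨⟨x, y⟩, hxy⟩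
  obtain ⟨⟨a, s⟩, rfl⟩ := gpi_surj f x
  obtain ⟨⟨b, t⟩, rfl⟩ := gpi_surj f y
  have hc : Continuous (fun c : CantorT × CantorT => (gpi f (c.1, s), gpi f (c.2, t))) :=
    ((continuous_gpi f).comp (by fun_prop)).prodMk ((continuous_gpi f).comp (by fun_prop))
  obtain ⟨c, ⟨n, hn⟩, hcO⟩ := hz.exists_mem_open (hO.preimage hc) ⟨(a, b), hxy⟩
  dsimp only at hn
  subst hn
  refine ⟨_, hcO, ⟨(s + (n : ℤ), t - s), ?_⟩⟩
  dsimp only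
  rw [Prod.map_iterate, Prod.map_fst, Prod.map_snd, iter_eq, iter_eq, ← gpi_shift, ← gpi_shift]
  congr 3
  ring

theorem line_dense (f : CantorT ≃ₜ CantorT) (p : CantorT)
    (hp : Dense (Set.range fun n : ℕ => (⇑f)^[n] p)) :
    DenseRange (fun w : ℝ => gpi f (p, w)) := by
  unfold DenseRange
  rw [dense_iff_inter_open]
  rintro O hO ⟨x, hx⟩
  obtain ⟨⟨a, s⟩, rfl⟩ := gpi_surj f x
  have hc : Continuous (fun c : CantorT => gpi f (c, s)) :=
    (continuous_gpi f).comp (by fun_prop)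
  obtain ⟨c, ⟨n, hn⟩, hcO⟩ := hp.exists_mem_open (hO.preimage hc) ⟨a, hx⟩
  dsimp only at hn
  subst hn
  refine ⟨_, hcO, ⟨s + (n : ℤ), ?_⟩⟩
  dsimp only
  rw [iter_eq, ← gpi_shift]

theorem strips_connected (P : ℤ → ℝ → Prop) (hP : ∀ n, ∃ s, P n s) (ε : ℝ) (h0 : 0 < ε)
    (h1 : ε ≤ 1 / 4) :
    IsConnected {w : ℝ × ℝ | ∀ n : ℤ, |w.2 - n| < ε → P n w.1} := by
  classical
  let a : ℤ → ℝ → ℝ := fun n s => if P n s then n - ε else n + ε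
  have ha1 : ∀ n s, a n s ≤ n + ε := by
    intro n s; simp only [a]; split_ifs <;> linarith
  have ha2 : ∀ n s, n - ε ≤ a n s := by
    intro n s; simp only [a]; split_ifs <;> linarith
  let B : ℤ → Set (ℝ × ℝ) := fun n => ⋃ s : ℝ,
    (({s} : Set ℝ) ×ˢ Icc (a n s) (n + 1 - ε) ∪ (univ : Set ℝ) ×ˢ ({(n : ℝ) + 1 / 2} : Set ℝ))
  have hB : ∀ n, IsPreconnected (B n) := by
    intro n
    refine isPreconnected_iUnion ⟨(0, n + 1 / 2), ?_⟩ ?_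
    · rw [mem_iInter]
      intro s
      right
      exact ⟨mem_univ _, rfl⟩
    · intro s
      have := ha1 n s
      refine IsPreconnected.union (s, (n : ℝ) + 1 / 2) ⟨rfl, by constructor <;> dsimp only <;> linarith⟩
        ⟨mem_univ _, rfl⟩ (isPreconnected_singleton.prod isPreconnected_Icc)
        (isPreconnected_univ.prod isPreconnected_singleton)
  have hU : {w : ℝ × ℝ | ∀ n : ℤ, |w.2 - n| < ε → P n w.1} = ⋃ n, B n := by
    ext ⟨s, u⟩
    simp only [mem_ofPred_eq, mem_iUnion, B]
    constructor
    · intro h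
      have e1 := Int.ceil_lt_add_one (u + ε)
      have e2 := Int.le_ceil (u + ε)
      refine ⟨⌈u + ε⌉ - 1, s, Or.inl ⟨rfl, ?_, ?_⟩⟩
      · simp only [a]
        split_ifs with hp
        · push_cast; linarith
        · by_contra hlt
          apply hp
          apply h
          push_cast at hlt ⊢
          rw [abs_lt]
          constructor <;> linarith
      · push_cast; linarith
    · rintro ⟨n, s', h | h⟩ m hm
      · obtain ⟨hs, hu1, hu2⟩ := h
        simp only [mem_singleton_iff] at hs
        subst hs
        dsimp only at hu1 hu2
        have h3 := ha2 n s
        rw [abs_lt] at hm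
        have e1 : (m : ℝ) < ((n + 1 : ℤ) : ℝ) := by push_cast; linarith
        have e2 : (n : ℝ) < ((m + 1 : ℤ) : ℝ) := by push_cast; linarith
        have e1' := Int.cast_lt.mp e1
        have e2' := Int.cast_lt.mp e2
        have : m = n := by omega
        subst this
        by_contra hp
        simp only [a, if_neg hp] at hu1
        linarith
      · obtain ⟨-, h⟩ := h
        simp only [mem_singleton_iff] at h
        subst h
        rw [abs_lt] at hm
        have e1 : (m : ℝ) < ((n + 1 : ℤ) : ℝ) := by push_cast; linarith
        have e2 : (n : ℝ) < ((m : ℤ) : ℝ) := by push_cast; linarith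
        have e1' := Int.cast_lt.mp e1
        have e2' := Int.cast_lt.mp e2
        omega
  rw [hU]
  constructor
  · refine ⟨(0, ((0 : ℤ) : ℝ) + 1 / 2), mem_iUnion.mpr ⟨0, mem_iUnion.mpr ⟨0, Or.inr ⟨mem_univ _, rfl⟩⟩⟩⟩
  · apply IsPreconnected.iUnion_of_chain hB
    intro n
    obtain ⟨s, hs⟩ := hP (n + 1)
    refine ⟨(s, n + 1 - ε), mem_iUnion.mpr ⟨s, Or.inl ⟨rfl, ?_⟩⟩, mem_iUnion.mpr ⟨s, Or.inl ⟨rfl, ?_⟩⟩⟩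
    · have := ha1 n s
      constructor <;> dsimp only <;> linarith
    · rw [Order.succ_eq_add_one]
      simp only [a, if_pos hs]
      push_cast
      constructor <;> linarith

theorem gates (f : CantorT ≃ₜ CantorT) (z : CantorT × CantorT)
    (hz : Dense (Set.range fun n : ℕ => (Prod.map ⇑f ⇑f)^[n] z)) (ε : ℝ) (h1 : ε ≤ 1 / 4) (n : ℤ) :
    ∃ s : ℝ, ε ≤ dist ((f ^ ⌊s⌋) z.1) ((f ^ (⌊s⌋ + n)) z.2) := by
  let O : Set (CantorT × CantorT) := {c | (1 : ℝ) / 2 < dist c.1 ((f ^ n) c.2)}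
  have hO : IsOpen O := isOpen_lt continuous_const
    (continuous_fst.dist ((f ^ n).continuous.comp continuous_snd))
  have h23 : (2 / 3 : ℝ) ∈ cantorSet := by
    rw [cantorSet_eq_union_halves]
    right
    exact ⟨0, zero_mem_cantorSet, by norm_num⟩
  have hne : O.Nonempty := by
    refine ⟨(⟨0, zero_mem_cantorSet⟩, (f ^ (-n)) ⟨2 / 3, h23⟩), ?_⟩
    simp only [O, mem_ofPred_eq]
    rw [← Homeomorph.mul_apply, ← zpow_add, add_neg_cancel, zpow_zero]
    change (1 : ℝ) / 2 < |(0 : ℝ) - 2 / 3|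
    rw [abs_of_nonpos] <;> norm_num
  obtain ⟨c, ⟨k, hk⟩, hc⟩ := hz.exists_mem_open hO hne
  dsimp only at hk
  subst hk
  refine ⟨((k : ℤ) : ℝ), ?_⟩
  rw [Int.floor_intCast]
  simp only [O, mem_ofPred_eq] at hc
  rw [Prod.map_iterate, Prod.map_fst, Prod.map_snd, iter_eq, iter_eq, ← Homeomorph.mul_apply,
    ← zpow_add, add_comm n] at hc
  linarith

theorem colocal (f : CantorT ≃ₜ CantorT) (z : CantorT × CantorT)
    (hz : Dense (Set.range fun n : ℕ => (Prod.map ⇑f ⇑f)^[n] z))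
    (U : Set (GlueSpace ⇑f × GlueSpace ⇑f)) (hU : IsOpen U)
    (hD : {w : GlueSpace ⇑f × GlueSpace ⇑f | w.1 = w.2} ⊆ U) :
    ∃ V : Set (GlueSpace ⇑f × GlueSpace ⇑f), IsOpen V ∧
          {w : GlueSpace ⇑f × GlueSpace ⇑f | w.1 = w.2} ⊆ V ∧ V ⊆ U ∧ IsConnected Vᶜ := by
  have hΔ : IsClosed {w : GlueSpace ⇑f × GlueSpace ⇑f | w.1 = w.2} :=
    isClosed_eq continuous_fst continuous_snd
  obtain ⟨U', hU'o, hDU', hU'U⟩ := normal_exists_closure_subset hΔ hU hD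
  let Q : (CantorT × ℝ) × (CantorT × ℝ) → GlueSpace ⇑f × GlueSpace ⇑f :=
    Prod.map (gpi f) (gpi f)
  have hQ : Continuous Q := (continuous_gpi f).prodMap (continuous_gpi f)
  have hKc : IsCompact ((fun a : CantorT × ℝ => (a, a)) '' ((univ : Set CantorT) ×ˢ Icc (0:ℝ) 1)) :=
    (isCompact_univ.prod isCompact_Icc).image (by fun_prop)
  obtain ⟨η, hη, hηU⟩ := hKc.exists_thickening_subset_open (hU'o.preimage hQ) (by
    rintro _ ⟨a, -, rfl⟩
    exact hDU' rfl)
  set ε := min η (1 / 4) with hε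
  have hε0 : 0 < ε := by positivity
  have hε1 : ε ≤ 1 / 4 := min_le_right _ _
  let E : Set (ℝ × ℝ) := {w : ℝ × ℝ | ∀ n : ℤ, |w.2 - n| < ε →
    ε ≤ dist ((f ^ ⌊w.1⌋) z.1) ((f ^ (⌊w.1⌋ + n)) z.2)}
  have hE : IsConnected E := strips_connected
    (fun n s => ε ≤ dist ((f ^ ⌊s⌋) z.1) ((f ^ (⌊s⌋ + n)) z.2)) (gates f z hz ε hε1) ε hε0 hε1
  let Φ : ℝ × ℝ → GlueSpace ⇑f × GlueSpace ⇑f :=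
    fun w => (gpi f (z.1, w.1), gpi f (z.2, w.1 + w.2))
  have hΦ : Continuous Φ :=
    ((continuous_gpi f).comp (by fun_prop)).prodMk ((continuous_gpi f).comp (by fun_prop))
  have hout : ∀ w, w ∉ E → Φ w ∈ U' := by
    intro w hw
    simp only [E, mem_ofPred_eq, not_forall, not_le] at hw
    obtain ⟨n, h1, h2⟩ := hw
    have e1 : Φ w = Q (((f ^ ⌊w.1⌋) z.1, w.1 - ⌊w.1⌋),
        ((f ^ (⌊w.1⌋ + n)) z.2, w.1 + w.2 - (⌊w.1⌋ + n : ℤ))) := by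
      simp only [Φ, Q, Prod.map]
      rw [← gpi_shift', ← gpi_shift']
    rw [e1]
    apply hηU
    rw [Metric.mem_thickening_iff]
    refine ⟨_, ⟨((f ^ ⌊w.1⌋) z.1, w.1 - ⌊w.1⌋), ⟨mem_univ _, Int.fract_nonneg _, (Int.fract_lt_one _).le⟩, rfl⟩, ?_⟩
    have hεη : ε ≤ η := min_le_left _ _
    rw [Prod.dist_eq, Prod.dist_eq, Prod.dist_eq]
    simp only [dist_self, max_self]
    refine max_lt hη (max_lt ?_ ?_)
    · rw [dist_comm]; exact h2.trans_le hεη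
    · rw [Real.dist_eq]
      push_cast
      convert h1.trans_le hεη using 2
      ring
  refine ⟨(closure (Φ '' E))ᶜ, isClosed_closure.isOpen_compl, ?_, ?_, ?_⟩
  · rintro ⟨x, y⟩ hxy
    simp only [mem_ofPred_eq] at hxy
    subst hxy
    obtain ⟨⟨a, b⟩, rfl⟩ := gpi_surj f x
    -- neighbourhoods
    have hnb : ∀ k : ℤ, ∃ S : Set CantorT, IsOpen S ∧ a ∈ S ∧
        ∀ c ∈ S, ∀ d ∈ S, dist ((f ^ k) c) ((f ^ k) d) < ε := by
      intro k
      refine ⟨(f ^ k) ⁻¹' Metric.ball ((f ^ k) a) (ε / 2), Metric.isOpen_ball.preimage (f ^ k).continuous,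
        Metric.mem_ball_self (by positivity), ?_⟩
      intro c hc d hd
      have h3 := dist_triangle_right ((f ^ k) c) ((f ^ k) d) ((f ^ k) a)
      have h1 : dist ((f ^ k) c) ((f ^ k) a) < ε / 2 := hc
      have h2 : dist ((f ^ k) d) ((f ^ k) a) < ε / 2 := hd
      linarith
    choose S hSo haS hS using hnb
    let N : Set (CantorT × ℝ) := (⋂ k ∈ Finset.Icc (⌊b⌋ - 2) (⌊b⌋ + 2), S k) ×ˢ Ioo (b - ε / 2) (b + ε / 2)
    have hN : IsOpen N :=
      (isOpen_biInter_finset (fun k _ => hSo k)).prod isOpen_Ioo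
    have haN : (a, b) ∈ N := by
      refine ⟨?_, by constructor <;> dsimp only <;> linarith⟩
      simp only [mem_iInter]
      exact fun k _ => haS k
    rw [mem_compl_iff, mem_closure_iff]
    push Not
    refine ⟨(gpi f '' N) ×ˢ (gpi f '' N), (isOpenMap_gpi f _ hN).prod (isOpenMap_gpi f _ hN),
      ⟨mem_image_of_mem _ haN, mem_image_of_mem _ haN⟩, ?_⟩
    rw [eq_empty_iff_forall_notMem]
    rintro _ ⟨⟨⟨c, hc, h1⟩, ⟨d, hd, h2⟩⟩, ⟨w, hw, rfl⟩⟩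
    obtain ⟨k, hk1, hk2⟩ := gpi_eq f h1.symm
    obtain ⟨j, hj1, hj2⟩ := gpi_eq f h2.symm
    dsimp only at hk1 hk2 hj1 hj2
    obtain ⟨hc1, hc2, hc3⟩ := hc
    obtain ⟨hd1, hd2, hd3⟩ := hd
    have h3 := hw (j - k) (by
      push_cast
      rw [abs_lt]
      constructor <;> linarith)
    have h4 := Int.floor_le w.1
    have h5 := Int.lt_floor_add_one w.1
    have h6 := Int.floor_le b
    have h7 := Int.lt_floor_add_one b
    have h8 : ⌊w.1⌋ - k ∈ Finset.Icc (⌊b⌋ - 2) (⌊b⌋ + 2) := by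
      rw [Finset.mem_Icc]
      have e1 : ((⌊b⌋ : ℤ) : ℝ) < ((⌊w.1⌋ - k + 2 : ℤ) : ℝ) := by push_cast; linarith
      have e2 : ((⌊w.1⌋ - k : ℤ) : ℝ) < ((⌊b⌋ + 2 : ℤ) : ℝ) := by push_cast; linarith
      have e1' := Int.cast_lt.mp e1
      have e2' := Int.cast_lt.mp e2
      constructor <;> omega
    simp only [mem_iInter] at hc1 hd1
    have h9 := hS _ _ (hc1 _ h8) _ (hd1 _ h8)
    rw [hk2, hj2, ← Homeomorph.mul_apply, ← Homeomorph.mul_apply, ← zpow_add, ← zpow_add] at h9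
    have e3 : ⌊w.1⌋ - k + k = ⌊w.1⌋ := by ring
    have e4 : ⌊w.1⌋ - k + j = ⌊w.1⌋ + (j - k) := by ring
    rw [e3, e4] at h9
    linarith
  · rw [compl_subset_comm]
    intro x hx
    have hx' : x ∈ (closure U')ᶜ := fun h => hx (hU'U h)
    have hd : Dense (range Φ) := plane_dense f z hz
    have h1 := hd.open_subset_closure_inter isClosed_closure.isOpen_compl hx'
    refine closure_mono ?_ h1
    rintro _ ⟨hy, w, rfl⟩
    refine ⟨w, ?_, rfl⟩
    by_contra hw
    exact hy (subset_closure (hout w hw))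
  · rw [compl_compl]
    exact (hE.image Φ hΦ.continuousOn).closure

theorem indecomp (f : CantorT ≃ₜ CantorT)
    (hmin : ∀ x : CantorT, Dense (Set.range fun n : ℕ => (⇑f)^[n] x))
    (hmin' : ∀ x : CantorT, Dense (Set.range fun n : ℕ => (⇑f.symm)^[n] x))
    (A B : Set (GlueSpace ⇑f)) (hA : IsClosed A) (hAc : IsPreconnected A) (hB : IsClosed B)
    (hA1 : A ≠ univ) (hB1 : B ≠ univ) (hAB : A ∪ B = univ) : False := by
  obtain ⟨x, hx⟩ := (ne_univ_iff_exists_notMem A).mp hA1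
  obtain ⟨y, hy⟩ := (ne_univ_iff_exists_notMem B).mp hB1
  obtain ⟨⟨g, t⟩, rfl⟩ := gpi_surj f x
  obtain ⟨⟨h, s⟩, rfl⟩ := gpi_surj f y
  have hsl : ∀ r : ℝ, Continuous (fun c : CantorT => gpi f (c, r)) := fun r =>
    (continuous_gpi f).comp (by fun_prop)
  let G : Set CantorT := (fun c : CantorT => gpi f (c, t)) ⁻¹' Aᶜ
  have hG : IsOpen G := hA.isOpen_compl.preimage (hsl t)
  let S : Set CantorT := (fun c : CantorT => gpi f (c, s)) ⁻¹' Bᶜ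
  have hS : IsOpen S := hB.isOpen_compl.preimage (hsl s)
  have hSA : ∀ c ∈ S, gpi f (c, s) ∈ A := by
    intro c hc
    have : gpi f (c, s) ∈ A ∪ B := hAB ▸ mem_univ _
    exact this.resolve_right hc
  have hhS : h ∈ S := hy
  have hgG : g ∈ G := hx
  -- forward crossing
  obtain ⟨m, hm1, hm2⟩ : ∃ m : ℤ, s < t + m ∧ (f ^ m) h ∈ G := by
    obtain ⟨N, hN⟩ := exists_nat_gt (s - t)
    obtain ⟨c, ⟨k, hk⟩, hc⟩ := (hmin ((f ^ (N : ℤ)) h)).exists_mem_open hG ⟨g, hgG⟩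
    dsimp only at hk
    rw [iter_eq, ← Homeomorph.mul_apply, ← zpow_add] at hk
    refine ⟨k + N, ?_, hk ▸ hc⟩
    have : (0 : ℝ) ≤ k := Nat.cast_nonneg k
    push_cast
    linarith
  obtain ⟨l, hl1, hl2⟩ : ∃ l : ℤ, t + l < s ∧ (f ^ l) h ∈ G := by
    obtain ⟨N, hN⟩ := exists_nat_gt (t - s)
    obtain ⟨c, ⟨k, hk⟩, hc⟩ := (hmin' ((f ^ (-(N : ℤ))) h)).exists_mem_open hG ⟨g, hgG⟩
    dsimp only at hk
    rw [iter_symm_eq, ← Homeomorph.mul_apply, ← zpow_add] at hk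
    refine ⟨-k + -N, ?_, hk ▸ hc⟩
    have : (0 : ℝ) ≤ k := Nat.cast_nonneg k
    push_cast
    linarith
  obtain ⟨M, hM⟩ : ∃ M : ℤ, ∀ r : ℝ, t + l < r → r < t + m → ∀ k : ℤ, s = r + k →
      k ∈ Icc (-M) M := by
    obtain ⟨M, hM⟩ := exists_nat_gt (|s - (t + l)| + |s - (t + m)|)
    refine ⟨M, ?_⟩
    intro r h1 h2 k h3
    have a1 := le_abs_self (s - (t + l))
    have a2 := neg_abs_le (s - (t + m))
    have a3 := abs_nonneg (s - (t + l))
    have a4 := abs_nonneg (s - (t + m))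
    constructor
    · have : ((-M : ℤ) : ℝ) < (k : ℝ) := by push_cast; linarith
      exact (Int.cast_lt.mp this).le
    · have : (k : ℝ) < ((M : ℤ) : ℝ) := by push_cast; linarith
      exact (Int.cast_lt.mp this).le
  -- another point of the slice
  have hfin : ((fun k : ℤ => (f ^ (-k)) h) '' Icc (-M) M).Finite := (Set.finite_Icc _ _).image _
  obtain ⟨h', hh'S, hh'⟩ := ((infinite_of_open f hmin S hS ⟨h, hhS⟩).diff hfin).nonempty
  let F : Set CantorT := (fun k : ℤ => (f ^ k) h') '' Icc (-M) M
  have hF : F.Finite := (Set.finite_Icc _ _).image _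
  have hhF : h ∉ F := by
    rintro ⟨k, hk, e⟩
    apply hh'
    refine ⟨k, hk, ?_⟩
    dsimp only at e ⊢
    rw [← e, ← Homeomorph.mul_apply, ← zpow_add, neg_add_cancel, zpow_zero]
    rfl
  obtain ⟨H, hHc, hhH, hHsub⟩ := compact_exists_isClopen_in_isOpen
    (U := ((f ^ m) ⁻¹' G ∩ (f ^ l) ⁻¹' G) ∩ Fᶜ)
    (((hG.preimage (f ^ m).continuous).inter (hG.preimage (f ^ l).continuous)).inter
      hF.isClosed.isOpen_compl) ⟨⟨hm2, hl2⟩, hhF⟩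
  let T : Set (GlueSpace ⇑f) := gpi f '' (H ×ˢ Ioo (t + l) (t + m))
  let T' : Set (GlueSpace ⇑f) := gpi f '' (H ×ˢ Icc (t + l) (t + m))
  have hT : IsOpen T := isOpenMap_gpi f _ (hHc.isOpen.prod isOpen_Ioo)
  have hT' : IsClosed T' :=
    ((hHc.isClosed.isCompact.prod isCompact_Icc).image (continuous_gpi f)).isClosed
  have hTT' : A ∩ T' ⊆ T := by
    rintro _ ⟨hcA, ⟨c, r⟩, ⟨hc, hr1, hr2⟩, rfl⟩
    dsimp only at hc hr1 hr2
    refine ⟨(c, r), ⟨hc, ?_, ?_⟩, rfl⟩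
    · refine lt_of_le_of_ne hr1 ?_
      rintro e
      dsimp only at e
      rw [← e, gpi_shift] at hcA
      exact (hHsub hc).1.2 hcA
    · refine lt_of_le_of_ne hr2 ?_
      rintro e
      dsimp only at e
      rw [e, gpi_shift] at hcA
      exact (hHsub hc).1.1 hcA
  have hsub : A ⊆ T := by
    refine hAc.subset_left_of_subset_union hT hT'.isOpen_compl ?_ ?_ ?_
    · rw [disjoint_compl_right_iff_subset]
      exact image_mono (prod_mono le_rfl Ioo_subset_Icc_self)
    · intro w hw
      by_cases h : w ∈ T'
      · exact Or.inl (hTT' ⟨hw, h⟩)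
      · exact Or.inr h
    · exact ⟨_, hSA h hhS, (h, s), ⟨hhH, hl1, hm1⟩, rfl⟩
  obtain ⟨⟨c, r⟩, ⟨hc, hr1, hr2⟩, e⟩ := hsub (hSA h' hh'S)
  obtain ⟨k, hk1, hk2⟩ := gpi_eq f e.symm
  dsimp only at hc hr1 hr2 hk1 hk2
  exact (hHsub hc).2 ⟨k, hM r hr1 hr2 k hk1, hk2.symm⟩

theorem glue_nontrivial (f : CantorT ≃ₜ CantorT) : Nontrivial (GlueSpace ⇑f) := by
  refine ⟨gpi f (⟨0, zero_mem_cantorSet⟩, 1 / 2), gpi f (⟨0, zero_mem_cantorSet⟩, 0), ?_⟩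
  intro h
  obtain ⟨k, hk, -⟩ := gpi_eq f h
  dsimp only at hk
  have h1 : (0 : ℝ) < (k : ℝ) := by linarith
  have h2 : (k : ℝ) < ((1 : ℤ) : ℝ) := by push_cast; linarith
  have h1' : 0 < k := by exact_mod_cast h1
  have h2' := Int.cast_lt.mp h2
  omega

theorem glue_connected (f : CantorT ≃ₜ CantorT)
    (hmin : ∀ x : CantorT, Dense (Set.range fun n : ℕ => (⇑f)^[n] x)) :
    ConnectedSpace (GlueSpace ⇑f) := by
  have hc : Continuous (fun w : ℝ => gpi f (⟨0, zero_mem_cantorSet⟩, w)) :=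
    (continuous_gpi f).comp (by fun_prop)
  have := (line_dense f ⟨0, zero_mem_cantorSet⟩ (hmin _)).preconnectedSpace hc
  exact { toNonempty := (glue_nontrivial f).to_nonempty }

theorem diag_interior {Y : Type*} [TopologicalSpace Y] [T2Space Y] [ConnectedSpace Y]
    [Nontrivial Y] : interior {w : Y × Y | w.1 = w.2} = ∅ := by
  rw [eq_empty_iff_forall_notMem]
  rintro ⟨x, y⟩ hw
  have hxy : x = y := (interior_subset (s := {w : Y × Y | w.1 = w.2})) hw
  subst hxy
  have ho : IsOpen ((fun y : Y => (x, y)) ⁻¹' interior {w : Y × Y | w.1 = w.2}) :=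
    isOpen_interior.preimage (by fun_prop)
  have he : (fun y : Y => (x, y)) ⁻¹' interior {w : Y × Y | w.1 = w.2} = {x} := by
    ext y
    constructor
    · intro h
      have : x = y := (interior_subset (s := {w : Y × Y | w.1 = w.2})) h
      exact this.symm
    · rintro rfl; exact hw
  rw [he] at ho
  have hcl : IsClopen ({x} : Set Y) := ⟨isClosed_singleton, ho⟩
  have hu := hcl.eq_univ ⟨x, rfl⟩
  obtain ⟨z, hz⟩ := exists_ne x
  have : z ∈ ({x} : Set Y) := hu ▸ mem_univ z
  exact hz this

/-- Suppose `f : C → C` is a homeomorphism of the Cantor set all of whose orbits are dense,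
all of whose inverse orbits are dense, and such that `f × f` has a dense orbit.  Then the
quotient space `X` of `C × [0,1]` gluing `(p,1)` to `(f p, 0)` is an indecomposable continuum
(compact, connected, metrizable, nondegenerate, and not the union of two proper subcontinua),
the diagonal `Δ ⊆ X²` has empty interior, and `Δ` is colocally connected in `X²`. -/
theorem glueSpace_indecomposable_and_diagonal_colocallyConnected
    (f : CantorT ≃ₜ CantorT)
    (hmin : ∀ x : CantorT, Dense (Set.range fun n : ℕ => (⇑f)^[n] x))
    (hmin' : ∀ x : CantorT, Dense (Set.range fun n : ℕ => (⇑f.symm)^[n] x))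
    (hwm : ∃ z : CantorT × CantorT, Dense (Set.range fun n : ℕ => (Prod.map ⇑f ⇑f)^[n] z)) :
    CompactSpace (GlueSpace ⇑f) ∧ ConnectedSpace (GlueSpace ⇑f) ∧
      TopologicalSpace.MetrizableSpace (GlueSpace ⇑f) ∧ Nontrivial (GlueSpace ⇑f) ∧
      (¬ ∃ A B : Set (GlueSpace ⇑f), IsCompact A ∧ IsConnected A ∧ IsCompact B ∧
        IsConnected B ∧ A ≠ univ ∧ B ≠ univ ∧ A ∪ B = univ) ∧
      interior {w : GlueSpace ⇑f × GlueSpace ⇑f | w.1 = w.2} = ∅ ∧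
      (∀ U : Set (GlueSpace ⇑f × GlueSpace ⇑f), IsOpen U →
        {w : GlueSpace ⇑f × GlueSpace ⇑f | w.1 = w.2} ⊆ U →
        ∃ V : Set (GlueSpace ⇑f × GlueSpace ⇑f), IsOpen V ∧
          {w : GlueSpace ⇑f × GlueSpace ⇑f | w.1 = w.2} ⊆ V ∧ V ⊆ U ∧ IsConnected Vᶜ) := by
  have hc := glue_connected f hmin
  have hn := glue_nontrivial f
  refine ⟨inferInstance, hc, inferInstance, hn, ?_, diag_interior, ?_⟩
  · rintro ⟨A, B, hA, hAc, hB, hBc, hA1, hB1, hAB⟩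
    exact indecomp f hmin hmin' A B hA.isClosed hAc.isPreconnected hB.isClosed hA1 hB1 hAB
  · intro U hU hD
    obtain ⟨z, hz⟩ := hwm
    exact colocal f z hz U hU hD
end
end

section
/- Let f : C → C be a homeomorphism of the Cantor ternary set such that every orbit of f is dense in C, every orbit of f⁻¹ is dense in C, and f × f : C² → C² has a dense orbit. Let X be the quotient space obtained from C × [0,1] by identifying, for each p ∈ C, the point (p,1) with (f(p),0). Then X² \ Δ is continuumwise connected in X²: for each pair of points p, q ∈ X² \ Δ there exists a subcontinuum M of X² such that {p,q} ⊆ M ⊆ X² \ Δ. -/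
open Set

noncomputable section

namespace GlueAux

instance : CompactSpace CantorT := isCompact_iff_compactSpace.1 isCompact_cantorSet

def i0 : UnitI := ⟨0, by norm_num, by norm_num⟩
def i1 : UnitI := ⟨1, by norm_num, by norm_num⟩

def nf (f : CantorT ≃ₜ CantorT) (a : CI) : CI :=
  open Classical in if (a.2 : ℝ) = 1 then (f a.1, i0) else a

lemma nf_eq_of_mk_eq (f : CantorT ≃ₜ CantorT) {a b : CI}
    (h : Quot.mk (glueRel f) a = Quot.mk (glueRel f) b) : nf f a = nf f b := by
  have key : ∀ a b, glueRel f a b → nf f a = nf f b := by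
    rintro ⟨p, s⟩ ⟨q, t⟩ ⟨h1, h2, h3⟩
    simp only at h1 h2 h3
    have : t = i0 := Subtype.ext h3
    subst this
    simp [nf, h1, h2, i0]
  exact congrArg (Quot.lift (nf f) key) h

lemma mk_nf (f : CantorT ≃ₜ CantorT) (a : CI) :
    Quot.mk (glueRel f) a = Quot.mk (glueRel f) (nf f a) := by
  unfold nf
  split_ifs with h
  · exact Quot.sound ⟨h, rfl, rfl⟩
  · rfl

lemma nf_lt (f : CantorT ≃ₜ CantorT) (a : CI) : ((nf f a).2 : ℝ) < 1 := by
  unfold nf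
  split_ifs with h
  · simp [i0]
  · exact lt_of_le_of_ne a.2.2.2 h

abbrev mk (f : CantorT ≃ₜ CantorT) (a : CI) : GlueSpace f := Quot.mk (glueRel f) a

lemma continuous_mk (f : CantorT ≃ₜ CantorT) : Continuous (mk f) := continuous_quot_mk

lemma mk_one (f : CantorT ≃ₜ CantorT) (p : CantorT) : mk f (p, i1) = mk f (f p, i0) :=
  Quot.sound ⟨rfl, rfl, rfl⟩

/-- same level: distinct. -/
lemma mk_ne_same (f : CantorT ≃ₜ CantorT) {p q : CantorT} (h : p ≠ q) (s : UnitI) :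
    mk f (p, s) ≠ mk f (q, s) := by
  intro e
  have := nf_eq_of_mk_eq f e
  unfold nf at this
  split_ifs at this with h1
  · simp at this; exact h this
  · simp at this; exact h this

lemma mk_ne_vert (f : CantorT ≃ₜ CantorT) {p q : CantorT} (h : p ≠ q) (h' : p ≠ f q) (s : UnitI) :
    mk f (p, i0) ≠ mk f (q, s) := by
  intro e
  have := nf_eq_of_mk_eq f e
  unfold nf at this
  simp only [i0, zero_ne_one, if_false] at this
  split_ifs at this with h1
  · simp at this; exact h' this
  · simp at this; exact h this.1

abbrev W (f : CantorT ≃ₜ CantorT) : Set (GlueSpace f × GlueSpace f) := {w | w.1 ≠ w.2}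

def Conn (f : CantorT ≃ₜ CantorT) (P Q : GlueSpace f × GlueSpace f) : Prop :=
  ∃ M : Set (GlueSpace f × GlueSpace f),
    IsCompact M ∧ IsConnected M ∧ P ∈ M ∧ Q ∈ M ∧ M ⊆ W f

variable {f : CantorT ≃ₜ CantorT}

lemma Conn.symm {P Q} (h : Conn f P Q) : Conn f Q P := by
  obtain ⟨M, h1, h2, h3, h4, h5⟩ := h
  exact ⟨M, h1, h2, h4, h3, h5⟩

lemma Conn.trans {P Q R} (h : Conn f P Q) (h' : Conn f Q R) : Conn f P R := by
  obtain ⟨M, h1, h2, h3, h4, h5⟩ := h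
  obtain ⟨M', k1, k2, k3, k4, k5⟩ := h'
  exact ⟨M ∪ M', h1.union k1, IsConnected.union ⟨Q, h4, k3⟩ h2 k2, Or.inl h3, Or.inr k4,
    union_subset h5 k5⟩

instance : ConnectedSpace UnitI := Subtype.connectedSpace (isConnected_Icc zero_le_one)

lemma Conn.path (γ : UnitI → CI × CI) (hγ : Continuous γ)
    (h : ∀ s, mk f (γ s).1 ≠ mk f (γ s).2) :
    Conn f (mk f (γ i0).1, mk f (γ i0).2) (mk f (γ i1).1, mk f (γ i1).2) := by
  have hc : Continuous (fun s => (mk f (γ s).1, mk f (γ s).2)) :=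
    ((continuous_mk f).comp (continuous_fst.comp hγ)).prodMk
      ((continuous_mk f).comp (continuous_snd.comp hγ))
  refine ⟨range (fun s => (mk f (γ s).1, mk f (γ s).2)), isCompact_range hc,
    isConnected_range hc, ⟨i0, rfl⟩, ⟨i1, rfl⟩, ?_⟩
  rintro _ ⟨s, rfl⟩
  exact h s

def lin (a b u : UnitI) : UnitI := ⟨(1 - u) * a + u * b, by
  obtain ⟨a, ha, ha'⟩ := a
  obtain ⟨b, hb, hb'⟩ := b
  obtain ⟨u, hu, hu'⟩ := u
  constructor
  · have := mul_nonneg (sub_nonneg.2 hu') ha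
    have := mul_nonneg hu hb
    simp only; linarith
  · simp only; nlinarith⟩

lemma lin_zero (a b : UnitI) : lin a b i0 = a := by simp [lin, i0]
lemma lin_one (a b : UnitI) : lin a b i1 = b := by simp [lin, i1]
lemma continuous_lin (a b : UnitI) : Continuous (lin a b) := by
  unfold lin; fun_prop

def cc (f : CantorT ≃ₜ CantorT) (P : CantorT × CantorT) : GlueSpace f × GlueSpace f :=
  (mk f (P.1, i0), mk f (P.2, i0))

lemma continuous_cc : Continuous (cc f) := by
  unfold cc
  exact ((continuous_mk f).comp (by fun_prop)).prodMk ((continuous_mk f).comp (by fun_prop))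

lemma Conn.vert {p q : CantorT} (h : p ≠ q) (h' : p ≠ f q) : Conn f (cc f (p, q)) (cc f (p, f q)) := by
  have := Conn.path (f := f) (fun s => ((p, i0), (q, s))) (by fun_prop)
    (fun s => mk_ne_vert f h h' s)
  simpa only [mk_one, cc] using this

lemma reduce (hfix : ∀ z, f z ≠ z) (P : GlueSpace f × GlueSpace f) (hP : P ∈ W f) :
    ∃ p q, p ≠ q ∧ Conn f P (cc f (p, q)) := by
  obtain ⟨x, y⟩ := P
  obtain ⟨a, rfl⟩ := Quot.exists_rep x
  obtain ⟨b, rfl⟩ := Quot.exists_rep y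
  have ha := nf_lt f a
  have hb := nf_lt f b
  rw [mk_nf f a, mk_nf f b] at hP ⊢
  generalize nf f a = a at *
  generalize nf f b = b at *
  obtain ⟨p, s⟩ := a
  obtain ⟨q, t⟩ := b
  simp only at ha hb
  by_cases hpq : p = q
  · subst hpq
    have aux : ∀ s t : UnitI, (s : ℝ) < t → ∀ u : UnitI,
        mk f (p, lin s i0 u) ≠ mk f (p, lin t i1 u) := by
      intro s t hst u e
      have e := nf_eq_of_mk_eq f e
      have hlt : (lin s i0 u : ℝ) < lin t i1 u := by
        obtain ⟨u, hu, hu'⟩ := u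
        simp only [lin, i0, i1]
        rcases eq_or_lt_of_le hu with h | h
        · subst h; linarith
        · nlinarith [mul_nonneg (sub_nonneg.2 hu') (sub_nonneg.2 hst.le)]
      have h1 : (lin t i1 u : ℝ) ≤ 1 := (lin t i1 u).2.2
      unfold nf at e
      rw [if_neg (ne_of_lt (lt_of_lt_of_le hlt h1))] at e
      split_ifs at e with h2
      · exact hfix p (congrArg Prod.fst e).symm
      · have := congrArg Prod.snd e
        simp only at this
        rw [this] at hlt
        exact lt_irrefl _ hlt
    have hst : (s : ℝ) ≠ t := fun e => hP (by rw [Subtype.ext e])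
    rcases lt_or_gt_of_ne hst with h | h
    · refine ⟨p, f p, (hfix p).symm, ?_⟩
      have := Conn.path (f := f) (fun u => ((p, lin s i0 u), (p, lin t i1 u)))
        (by have := continuous_lin s i0; have := continuous_lin t i1; fun_prop) (aux s t h)
      simpa only [lin_zero, lin_one, mk_one, cc] using this
    · refine ⟨f p, p, (hfix p), ?_⟩
      have := Conn.path (f := f) (fun u => ((p, lin s i1 u), (p, lin t i0 u)))
        (by have := continuous_lin s i1; have := continuous_lin t i0; fun_prop)
        (fun u => (aux t s h u).symm)
      simpa only [lin_zero, lin_one, mk_one, cc] using this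
  · refine ⟨p, q, hpq, ?_⟩
    have := Conn.path (f := f) (fun u => ((p, lin s i0 u), (q, lin t i0 u)))
      (by have := continuous_lin s i0; have := continuous_lin t i0; fun_prop) ?_
    · simpa only [lin_zero, lin_one, mk_one, cc] using this
    · intro u e
      have e := nf_eq_of_mk_eq f e
      have aux : ∀ s : UnitI, (s : ℝ) < 1 → ((lin s i0 u : UnitI) : ℝ) ≠ 1 := by
        intro s hs
        obtain ⟨u, hu, hu'⟩ := u
        obtain ⟨s, hs0, hs1⟩ := s
        simp only [lin, i0] at *
        apply ne_of_lt
        nlinarith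
      unfold nf at e
      rw [if_neg (aux s ha), if_neg (aux t hb)] at e
      exact hpq (congrArg Prod.fst e)

def Edge (f : CantorT ≃ₜ CantorT) (L : Set (CantorT × CantorT)) (P Q : CantorT × CantorT) : Prop :=
  P ∈ L ∧ Q ∈ L ∧ (Q = (f P.1, f P.2) ∨ Q = (P.1, f P.2))

lemma conn_of_edges {L : Set (CantorT × CantorT)} (hL : IsClosed L) (hd : ∀ P ∈ L, P.1 ≠ P.2)
    {P Q : CantorT × CantorT} (hP : P ∈ L) (hQ : Q ∈ L)
    (h : Q ∈ closure {Q' | Relation.EqvGen (Edge f L) P Q'}) : Conn f (cc f P) (cc f Q) := by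
  let gD : (CantorT × CantorT) × UnitI → GlueSpace f × GlueSpace f :=
    fun x => (mk f (x.1.1, x.2), mk f (x.1.2, x.2))
  let gV : (CantorT × CantorT) × UnitI → GlueSpace f × GlueSpace f :=
    fun x => (mk f (x.1.1, i0), mk f (x.1.2, x.2))
  have hgD : Continuous gD :=
    ((continuous_mk f).comp (by fun_prop)).prodMk ((continuous_mk f).comp (by fun_prop))
  have hgV : Continuous gV :=
    ((continuous_mk f).comp (by fun_prop)).prodMk ((continuous_mk f).comp (by fun_prop))
  let LV : Set (CantorT × CantorT) := L ∩ (fun P => (P.1, f P.2)) ⁻¹' L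
  have hLV : IsClosed LV := hL.inter (hL.preimage (by fun_prop))
  let K := gD '' (L ×ˢ univ) ∪ gV '' (LV ×ˢ univ)
  have hK : IsCompact K := ((hL.isCompact.prod isCompact_univ).image hgD).union
    ((hLV.isCompact.prod isCompact_univ).image hgV)
  have hKW : K ⊆ W f := by
    rintro _ (⟨⟨P, s⟩, ⟨hP, -⟩, rfl⟩ | ⟨⟨P, s⟩, ⟨⟨hP, hP'⟩, -⟩, rfl⟩)
    · exact mk_ne_same f (hd P hP) s
    · exact mk_ne_vert f (hd P hP) (hd _ hP') s
  have hcK : ∀ P ∈ L, cc f P ∈ K := fun P hP => Or.inl ⟨(P, i0), ⟨hP, mem_univ _⟩, rfl⟩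
  have hstep : ∀ P Q, Edge f L P Q →
      connectedComponentIn K (cc f P) = connectedComponentIn K (cc f Q) := by
    rintro P Q ⟨hP, hQ, rfl | rfl⟩
    · apply connectedComponentIn_eq
      have hpre : IsPreconnected (range (fun s => gD (P, s))) :=
        isPreconnected_range (by fun_prop)
      refine hpre.subset_connectedComponentIn (x := cc f P) ⟨i0, rfl⟩ ?_ ⟨i1, ?_⟩
      · rintro _ ⟨s, rfl⟩
        exact Or.inl ⟨(P, s), ⟨hP, mem_univ _⟩, rfl⟩
      · simp only [gD, cc, mk_one]
    · apply connectedComponentIn_eq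
      have hpre : IsPreconnected (range (fun s => gV (P, s))) :=
        isPreconnected_range (by fun_prop)
      refine hpre.subset_connectedComponentIn (x := cc f P) ⟨i0, rfl⟩ ?_ ⟨i1, ?_⟩
      · rintro _ ⟨s, rfl⟩
        exact Or.inr ⟨(P, s), ⟨⟨hP, hQ⟩, mem_univ _⟩, rfl⟩
      · simp only [gV, cc, mk_one]
  have hall : ∀ P Q, Relation.EqvGen (Edge f L) P Q →
      connectedComponentIn K (cc f P) = connectedComponentIn K (cc f Q) := by
    intro P Q h
    induction h with
    | rel _ _ h => exact hstep _ _ h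
    | refl => rfl
    | symm _ _ _ ih => exact ih.symm
    | trans _ _ _ _ _ ih1 ih2 => exact ih1.trans ih2
  have hne : (connectedComponentIn K (cc f P)).Nonempty :=
    connectedComponentIn_nonempty_iff.2 (hcK P hP)
  have hsub : ∀ Q', Relation.EqvGen (Edge f L) P Q' → cc f Q' ∈ connectedComponentIn K (cc f P) := by
    intro Q' h
    rw [hall _ _ h] at hne ⊢
    exact mem_connectedComponentIn (connectedComponentIn_nonempty_iff.1 hne)
  have hcl : cc f Q ∈ closure (connectedComponentIn K (cc f P)) :=
    map_mem_closure continuous_cc h hsub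
  refine ⟨closure (connectedComponentIn K (cc f P)) ∩ K, hK.inter_left isClosed_closure, ?_,
    ⟨subset_closure (hsub P (.refl _)), hcK P hP⟩, ⟨hcl, hcK Q hQ⟩, inter_subset_right.trans hKW⟩
  exact IsConnected.subset_closure ⟨hne, isPreconnected_connectedComponentIn⟩
    (subset_inter subset_closure (connectedComponentIn_subset _ _)) inter_subset_left

lemma cantor_cases (x : CantorT) : (x : ℝ) ≤ 1 / 3 ∨ 2 / 3 ≤ (x : ℝ) := by
  have h : (x : ℝ) ∈ preCantorSet 1 := mem_iInter.1 x.2 1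
  rw [preCantorSet_succ, preCantorSet_zero] at h
  rcases h with ⟨y, hy, h⟩ | ⟨y, hy, h⟩
  · left; simp only at h; rw [← h]; linarith [hy.2]
  · right; simp only at h; rw [← h]; linarith [hy.1]

def cz : CantorT := ⟨0, zero_mem_cantorSet⟩
def ct : CantorT := ⟨2 / 3, by
  rw [cantorSet_eq_union_halves]
  right
  exact ⟨0, zero_mem_cantorSet, by norm_num⟩⟩

def A : Set CantorT := {x | (x : ℝ) ≤ 1 / 3}

lemma isClopen_A : IsClopen A := by
  refine ⟨isClosed_le (by fun_prop) (by fun_prop), ?_⟩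
  have : A = {x : CantorT | (x : ℝ) < 2 / 3} := by
    ext x
    simp only [A, mem_ofPred_eq]
    constructor
    · intro h; linarith
    · intro h
      rcases cantor_cases x with h' | h'
      · exact h'
      · linarith
  rw [this]
  exact isOpen_lt (by fun_prop) (by fun_prop)

lemma A_close {x y : CantorT} (h : dist x y < 1 / 3) : x ∈ A ↔ y ∈ A := by
  rw [Subtype.dist_eq, Real.dist_eq, abs_lt] at h
  simp only [A, mem_ofPred_eq]
  rcases cantor_cases x with hx | hx <;> rcases cantor_cases y with hy | hy <;>
    constructor <;> intro h' <;> linarith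

lemma no_unif_nat (hwm : ∃ z : CantorT × CantorT, Dense (Set.range fun n : ℕ => (Prod.map ⇑f ⇑f)^[n] z))
    (i : ℕ) (hi : 0 < i) (h : ∀ z, dist z (f^[i] z) < 1 / 3) : False := by
  obtain ⟨z, hz⟩ := hwm
  have hper : ∀ z, z ∈ A ↔ f^[i] z ∈ A := fun z => A_close (h z)
  let D : Set (CantorT × CantorT) := {w | ∀ s ∈ Finset.range i, (f^[s] w.1 ∈ A ↔ f^[s] w.2 ∈ A)}
  have hcl : IsClopen D := by
    have : D = ⋂ s ∈ Finset.range i, {w : CantorT × CantorT | (f^[s] w.1 ∈ A ↔ f^[s] w.2 ∈ A)} := by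
      ext w; simp [D]
    rw [this]
    refine isClopen_biInter_finset fun s _ => ?_
    have hfs : Continuous f^[s] := f.continuous.iterate s
    have h1 : IsClopen {w : CantorT × CantorT | f^[s] w.1 ∈ A} :=
      isClopen_A.preimage (hfs.comp continuous_fst)
    have h2 : IsClopen {w : CantorT × CantorT | f^[s] w.2 ∈ A} :=
      isClopen_A.preimage (hfs.comp continuous_snd)
    convert (h1.inter h2).union (h1.compl.inter h2.compl) using 1
    ext w
    simp only [mem_ofPred_eq, mem_union, mem_inter_iff, mem_compl_iff]
    tauto
  have hinv : ∀ w, Prod.map f f w ∈ D ↔ w ∈ D := by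
    intro w
    simp only [D, mem_ofPred_eq, Finset.mem_range, Prod.map_fst, Prod.map_snd,
      ← Function.iterate_succ_apply]
    constructor
    · intro hw s hs
      rcases s with _ | s
      · have := hw (i - 1) (by omega)
        rw [show (i - 1).succ = i by omega] at this
        rw [← hper, ← hper] at this
        simpa using this
      · exact hw s (by omega)
    · intro hw s hs
      by_cases hs' : s + 1 = i
      · rw [Nat.succ_eq_add_one, hs', ← hper, ← hper]
        simpa using hw 0 hi
      · exact hw (s + 1) (by omega)
  have hinvn : ∀ n w, (Prod.map f f)^[n] w ∈ D ↔ w ∈ D := by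
    intro n
    induction n with
    | zero => intro w; rfl
    | succ n ih => intro w; rw [Function.iterate_succ_apply, ih, hinv]
  obtain ⟨w, hw, ⟨n, rfl⟩⟩ := hz.inter_open_nonempty D hcl.isOpen
    ⟨(cz, cz), fun s _ => Iff.rfl⟩
  have hzD : z ∈ D := (hinvn n z).1 hw
  have hsub : closure (range fun n : ℕ => (Prod.map f f)^[n] z) ⊆ D := by
    refine closure_minimal ?_ hcl.isClosed
    rintro _ ⟨m, rfl⟩
    exact (hinvn m z).2 hzD
  have := hsub (hz (cz, ct)) 0 (by simpa using hi)
  simp [A, cz, ct] at this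
  norm_num at this

lemma pow_apply (n : ℕ) (x : CantorT) : (f ^ (n : ℤ)) x = f^[n] x := by
  rw [zpow_natCast]
  induction n with
  | zero => rfl
  | succ n ih => rw [pow_succ', Function.iterate_succ_apply', ← ih]; rfl

lemma zadd (n m : ℤ) (x : CantorT) : (f ^ (n + m)) x = (f ^ n) ((f ^ m) x) := by
  rw [zpow_add]; rfl

lemma zsucc (n : ℤ) (x : CantorT) : (f ^ (n + 1)) x = f ((f ^ n) x) := by
  rw [add_comm, zadd, zpow_one]

lemma no_unif (hwm : ∃ z : CantorT × CantorT, Dense (Set.range fun n : ℕ => (Prod.map ⇑f ⇑f)^[n] z))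
    (i : ℤ) (hi : i ≠ 0) (h : ∀ z, dist z ((f ^ i) z) < 1 / 3) : False := by
  rcases lt_or_gt_of_ne hi with h' | h'
  · obtain ⟨n, hn⟩ := Int.eq_ofNat_of_zero_le (show 0 ≤ -i by omega)
    refine no_unif_nat hwm n (by omega) fun z => ?_
    have := h ((f ^ (-i)) z)
    rw [← zadd, add_neg_cancel, hn, pow_apply, dist_comm] at this
    exact this
  · obtain ⟨n, hn⟩ := Int.eq_ofNat_of_zero_le h'.le
    refine no_unif_nat hwm n (by omega) fun z => ?_
    have := h z
    rw [hn, pow_apply] at this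
    exact this

/-- a point whose orbit is almost fixed by `f ^ i`. -/
lemma no_unif' (hmin : ∀ x : CantorT, Dense (Set.range fun n : ℕ => (⇑f)^[n] x))
    (hwm : ∃ z : CantorT × CantorT, Dense (Set.range fun n : ℕ => (Prod.map ⇑f ⇑f)^[n] z))
    (i : ℤ) (hi : i ≠ 0) (x : CantorT)
    (h : ∀ k : ℤ, dist ((f ^ k) x) ((f ^ (i + k)) x) ≤ 1 / 4) : False := by
  refine no_unif hwm i hi fun z => ?_
  have hcl : IsClosed {z | dist z ((f ^ i) z) ≤ 1 / 4} :=
    isClosed_le (continuous_id.dist (f ^ i).continuous) continuous_const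
  have : z ∈ {z | dist z ((f ^ i) z) ≤ 1 / 4} := by
    refine closure_minimal ?_ hcl (hmin x z)
    rintro _ ⟨n, rfl⟩
    have := h n
    rw [zadd, pow_apply] at this
    exact this
  simp only [mem_ofPred_eq] at this
  linarith

lemma aperiodic (hmin : ∀ x : CantorT, Dense (Set.range fun n : ℕ => (⇑f)^[n] x))
    (hwm : ∃ z : CantorT × CantorT, Dense (Set.range fun n : ℕ => (Prod.map ⇑f ⇑f)^[n] z))
    (i : ℤ) (hi : i ≠ 0) (x : CantorT) : (f ^ i) x ≠ x := by
  intro h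
  refine no_unif' hmin hwm i hi x fun k => ?_
  rw [add_comm, zadd, h, dist_self]
  norm_num

lemma exists_off (hwm : ∃ z : CantorT × CantorT, Dense (Set.range fun n : ℕ => (Prod.map ⇑f ⇑f)^[n] z)) :
    ∃ x y : CantorT, ∀ k : ℤ, (f ^ k) x ≠ y := by
  obtain ⟨z, hz⟩ := hwm
  refine ⟨z.1, z.2, fun k hk => ?_⟩
  have hcl : IsClosed {w : CantorT × CantorT | (f ^ k) w.1 = w.2} :=
    isClosed_eq ((f ^ k).continuous.comp continuous_fst) continuous_snd
  have hall : ∀ w : CantorT × CantorT, (f ^ k) w.1 = w.2 := by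
    intro w
    refine closure_minimal ?_ hcl (hz w)
    rintro _ ⟨n, rfl⟩
    simp only [Prod.map_iterate, Prod.map_fst, Prod.map_snd, mem_ofPred_eq]
    rw [← hk, ← pow_apply, ← pow_apply, ← zadd, ← zadd, add_comm]
  have h1 := hall (cz, cz)
  have h2 := hall (cz, ct)
  have : cz = ct := h1.symm.trans h2
  simp [cz, ct] at this
  norm_num at this

lemma exists_delta (hmin : ∀ x : CantorT, Dense (Set.range fun n : ℕ => (⇑f)^[n] x))
    (hwm : ∃ z : CantorT × CantorT, Dense (Set.range fun n : ℕ => (Prod.map ⇑f ⇑f)^[n] z))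
    (x y : CantorT) (hxy : ∀ k : ℤ, (f ^ k) x ≠ y) :
    ∃ δ > 0, ∀ j : ℤ, ∃ k : ℤ, δ ≤ dist ((f ^ k) x) ((f ^ (k + j)) y) := by
  by_contra! hcon
  obtain ⟨j, hj⟩ := hcon (1 / 8) (by norm_num)
  have hpos : 0 < dist x ((f ^ j) y) := by
    rw [dist_pos]
    intro e
    apply hxy (-j)
    rw [e, ← zadd]
    simp
  obtain ⟨j', hj'⟩ := hcon (min (1 / 8) (dist x ((f ^ j) y))) (lt_min (by norm_num) hpos)
  have hne : j' - j ≠ 0 := by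
    intro e
    have : j' = j := by omega
    subst this
    have := hj' 0
    rw [zero_add] at this
    exact absurd (this.trans_le (min_le_right _ _)) (lt_irrefl _)
  refine no_unif' hmin hwm (j' - j) hne y fun k => ?_
  have h1 := hj (k - j)
  have h2 := (hj' (k - j)).trans_le (min_le_left _ _)
  rw [sub_add_cancel] at h1
  rw [show k - j + j' = j' - j + k by ring] at h2
  have := dist_triangle_left ((f ^ k) y) ((f ^ (j' - j + k)) y) ((f ^ (k - j)) x)
  linarith

lemma exists_eps (hfix : ∀ z, f z ≠ z) : ∃ ε > 0, ∀ z, ε ≤ dist z (f z) := by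
  obtain ⟨z, -, hz⟩ := isCompact_univ.exists_isMinOn (⟨cz, mem_univ _⟩ : (univ : Set CantorT).Nonempty)
    (f := fun z => dist z (f z)) (by fun_prop)
  exact ⟨dist z (f z), dist_pos.2 (hfix z).symm, fun w => hz (mem_univ w)⟩

section lattice

variable {L : Set (CantorT × CantorT)} {x y : CantorT}

def gg (f : CantorT ≃ₜ CantorT) (x y : CantorT) (j k : ℤ) : CantorT × CantorT :=
  ((f ^ k) x, (f ^ (k + j)) y)

lemma edgeD {j k : ℤ} (h : gg f x y j k ∈ L) (h' : gg f x y j (k + 1) ∈ L) :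
    Relation.EqvGen (Edge f L) (gg f x y j k) (gg f x y j (k + 1)) := by
  refine .rel _ _ ⟨h, h', Or.inl ?_⟩
  simp only [gg]
  rw [zsucc, show k + 1 + j = k + j + 1 by ring, zsucc]

lemma edgeV {j k : ℤ} (h : gg f x y j k ∈ L) (h' : gg f x y (j + 1) k ∈ L) :
    Relation.EqvGen (Edge f L) (gg f x y j k) (gg f x y (j + 1) k) := by
  refine .rel _ _ ⟨h, h', Or.inr ?_⟩
  simp only [gg]
  rw [← add_assoc, zsucc]

/-- all good points of two adjacent columns are connected. -/
lemma cols (h1 : ∀ j k, gg f x y j k ∉ L → gg f x y (j + 1) k ∈ L ∧ gg f x y (j + 1) (k + 1) ∈ L)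
    (h2 : ∀ j k, gg f x y (j + 1) k ∉ L → gg f x y j k ∈ L ∧ gg f x y j (k + 1) ∈ L) (j k l : ℤ)
    (a b : ℤ) (ha : a = j ∨ a = j + 1) (hb : b = j ∨ b = j + 1)
    (hk : gg f x y a k ∈ L) (hl : gg f x y b l ∈ L) :
    Relation.EqvGen (Edge f L) (gg f x y a k) (gg f x y b l) := by
  -- same level
  have same : ∀ k a b : ℤ, (a = j ∨ a = j + 1) → (b = j ∨ b = j + 1) → gg f x y a k ∈ L →
      gg f x y b k ∈ L → Relation.EqvGen (Edge f L) (gg f x y a k) (gg f x y b k) := by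
    rintro k a b (rfl | rfl) (rfl | rfl) h h'
    · exact .refl _
    · exact edgeV h h'
    · exact .symm _ _ (edgeV h' h)
    · exact .refl _
  have ex : ∀ k, ∃ c, (c = j ∨ c = j + 1) ∧ gg f x y c k ∈ L ∧ gg f x y c (k + 1) ∈ L := by
    intro k
    by_cases c1 : gg f x y j k ∈ L
    · by_cases c2 : gg f x y j (k + 1) ∈ L
      · exact ⟨j, Or.inl rfl, c1, c2⟩
      · by_cases c3 : gg f x y (j + 1) k ∈ L
        · exact ⟨j + 1, Or.inr rfl, c3, (h1 _ _ c2).1⟩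
        · exact ⟨j, Or.inl rfl, h2 _ _ c3⟩
    · exact ⟨j + 1, Or.inr rfl, h1 _ _ c1⟩
  have up : ∀ n : ℕ, ∀ k a b : ℤ, (a = j ∨ a = j + 1) → (b = j ∨ b = j + 1) → gg f x y a k ∈ L →
      gg f x y b (k + n) ∈ L → Relation.EqvGen (Edge f L) (gg f x y a k) (gg f x y b (k + n)) := by
    intro n
    induction n with
    | zero =>
      intro k a b ha hb h h'
      simp only [Nat.cast_zero, add_zero] at h' ⊢
      exact same k a b ha hb h h'
    | succ n ih =>
      intro k a b ha hb h h'
      obtain ⟨c, hc, c1, c2⟩ := ex (k + n)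
      push_cast at h' ⊢
      rw [← add_assoc] at h' ⊢
      exact .trans _ _ _ (ih k a c ha hc h c1) (.trans _ _ _ (edgeD c1 c2) (same _ c b hc hb c2 h'))
  rcases le_total k l with h | h
  · obtain ⟨n, hn⟩ := Int.eq_ofNat_of_zero_le (sub_nonneg.2 h)
    obtain rfl : l = k + n := by omega
    exact up n k a b ha hb hk hl
  · obtain ⟨n, hn⟩ := Int.eq_ofNat_of_zero_le (sub_nonneg.2 h)
    obtain rfl : k = l + n := by omega
    exact .symm _ _ (up n l b a hb ha hl hk)

lemma allgood (h1 : ∀ j k, gg f x y j k ∉ L → gg f x y (j + 1) k ∈ L ∧ gg f x y (j + 1) (k + 1) ∈ L)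
    (h2 : ∀ j k, gg f x y (j + 1) k ∉ L → gg f x y j k ∈ L ∧ gg f x y j (k + 1) ∈ L)
    (h3 : ∀ j, ∃ k, gg f x y j k ∈ L) (a b k l : ℤ)
    (hk : gg f x y a k ∈ L) (hl : gg f x y b l ∈ L) :
    Relation.EqvGen (Edge f L) (gg f x y a k) (gg f x y b l) := by
  have up : ∀ n : ℕ, ∀ a k l : ℤ, gg f x y a k ∈ L → gg f x y (a + n) l ∈ L →
      Relation.EqvGen (Edge f L) (gg f x y a k) (gg f x y (a + n) l) := by
    intro n
    induction n with
    | zero =>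
      intro a k l h h'
      simp only [Nat.cast_zero, add_zero] at h' ⊢
      exact cols h1 h2 a k l a a (Or.inl rfl) (Or.inl rfl) h h'
    | succ n ih =>
      intro a k l h h'
      obtain ⟨m, hm⟩ := h3 (a + n)
      push_cast at h' ⊢
      rw [← add_assoc] at h' ⊢
      exact .trans _ _ _ (ih a k m h hm)
        (cols h1 h2 (a + n) m l _ _ (Or.inl rfl) (Or.inr rfl) hm h')
  rcases le_total a b with h | h
  · obtain ⟨n, hn⟩ := Int.eq_ofNat_of_zero_le (sub_nonneg.2 h)
    obtain rfl : b = a + n := by omega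
    exact up n a k l hk hl
  · obtain ⟨n, hn⟩ := Int.eq_ofNat_of_zero_le (sub_nonneg.2 h)
    obtain rfl : a = b + n := by omega
    exact .symm _ _ (up n b l k hl hk)

end lattice

lemma off_conn (hmin : ∀ x : CantorT, Dense (Set.range fun n : ℕ => (⇑f)^[n] x))
    (hwm : ∃ z : CantorT × CantorT, Dense (Set.range fun n : ℕ => (Prod.map ⇑f ⇑f)^[n] z))
    (x y : CantorT) (hxy : ∀ k : ℤ, (f ^ k) x ≠ y) :
    Conn f (cc f (x, y)) (cc f (x, f x)) ∧ Conn f (cc f (x, y)) (cc f (x, f.symm x)) := by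
  have hfix : ∀ z, f z ≠ z := fun z => by simpa using aperiodic hmin hwm 1 one_ne_zero z
  obtain ⟨ε, hε, hεf⟩ := exists_eps hfix
  obtain ⟨δ₁, hδ₁, h3⟩ := exists_delta hmin hwm x y hxy
  have huc : UniformContinuous f := CompactSpace.uniformContinuous_of_continuous f.continuous
  obtain ⟨δ₂, hδ₂, hu⟩ := Metric.uniformContinuous_iff.1 huc (ε / 2) (half_pos hε)
  have hd0 : 0 < dist x y := dist_pos.2 (by simpa using hxy 0)
  obtain ⟨δ, hδ, e1, e2, e3, e4⟩ : ∃ δ > 0, δ ≤ δ₁ ∧ δ ≤ δ₂ ∧ δ ≤ ε / 2 ∧ δ ≤ dist x y :=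
    ⟨min (min δ₁ δ₂) (min (ε / 2) (dist x y)), by positivity, by simp, by simp, by simp, by simp⟩
  let L : Set (CantorT × CantorT) := {w | δ ≤ dist w.1 w.2}
  have hL : IsClosed L := isClosed_le (by fun_prop) (by fun_prop)
  have hd : ∀ P ∈ L, P.1 ≠ P.2 := fun P hP => dist_pos.1 (lt_of_lt_of_le hδ hP)
  have m1 : ∀ p q, (p, q) ∉ L → (p, f q) ∈ L ∧ (f p, f (f q)) ∈ L := by
    intro p q h
    simp only [L, mem_ofPred_eq, not_le] at h ⊢
    have := hu (h.trans_le e2)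
    have t1 := dist_triangle_left q (f q) p
    have t2 := dist_triangle_left (f q) (f (f q)) (f p)
    have := hεf q
    have := hεf (f q)
    constructor <;> linarith
  have m2 : ∀ p q, (p, f q) ∉ L → (p, q) ∈ L ∧ (f p, f q) ∈ L := by
    intro p q h
    simp only [L, mem_ofPred_eq, not_le] at h ⊢
    have := hu (h.trans_le e2)
    have t1 := dist_triangle_left q (f q) p
    have t2 := dist_triangle_left (f q) (f (f q)) (f p)
    have := hεf q
    have := hεf (f q)
    constructor <;> linarith
  have r1 : ∀ j k, gg f x y (j + 1) k = ((f ^ k) x, f ((f ^ (k + j)) y)) := by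
    intro j k; simp only [gg]; rw [← add_assoc, zsucc]
  have r2 : ∀ j k, gg f x y j (k + 1) = (f ((f ^ k) x), f ((f ^ (k + j)) y)) := by
    intro j k; simp only [gg]; rw [zsucc, show k + 1 + j = k + j + 1 by ring, zsucc]
  have r3 : ∀ j k, gg f x y (j + 1) (k + 1) = (f ((f ^ k) x), f (f ((f ^ (k + j)) y))) := by
    intro j k; rw [r1, zsucc, show k + 1 + j = k + j + 1 by ring, zsucc]
  have good := allgood (f := f) (L := L) (x := x) (y := y)
    (fun j k h => by rw [r1, r3]; exact m1 _ _ h)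
    (fun j k h => by rw [r1] at h; rw [r2]; exact m2 _ _ h)
    (fun j => by obtain ⟨k, hk⟩ := h3 j; exact ⟨k, e1.trans hk⟩)
  have h00 : gg f x y 0 0 = (x, y) := by simp [gg]
  have hxyL : (x, y) ∈ L := e4
  have key : ∀ q, δ < dist x q → Conn f (cc f (x, y)) (cc f (x, q)) := by
    intro q hq
    refine conn_of_edges hL hd hxyL (show (x, q) ∈ L from hq.le) ?_
    rw [Metric.mem_closure_iff]
    intro η hη
    obtain ⟨_, hn, ⟨n, rfl⟩⟩ := Metric.dense_iff.1 (hmin y) q (min η (dist x q - δ))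
      (lt_min hη (sub_pos.2 hq))
    rw [Metric.mem_ball] at hn
    simp only at hn
    have hg : gg f x y n 0 = (x, f^[n] y) := by
      simp only [gg]; rw [zero_add, pow_apply]; simp
    refine ⟨(x, f^[n] y), ?_, ?_⟩
    · have := good 0 n 0 0 (by rw [h00]; exact hxyL) (by
        rw [hg]
        have t := dist_triangle x (f^[n] y) q
        have := hn.trans_le (min_le_right _ _)
        simp only [L, mem_ofPred_eq]
        linarith)
      rw [h00, hg] at this
      exact this
    · rw [Prod.dist_eq, max_lt_iff]
      simp only [dist_self]
      exact ⟨hη, by rw [dist_comm]; exact hn.trans_le (min_le_left _ _)⟩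
  constructor
  · exact key _ (by linarith [hεf x])
  · refine key _ ?_
    have := hεf (f.symm x)
    rw [f.apply_symm_apply, dist_comm] at this
    linarith

lemma graph_conn (hmin : ∀ x : CantorT, Dense (Set.range fun n : ℕ => (⇑f)^[n] x))
    (e : CantorT ≃ₜ CantorT) (he : ∀ z, e z ≠ z) (hc : ∀ z, e (f z) = f (e z)) (p p' : CantorT) :
    Conn f (cc f (p, e p)) (cc f (p', e p')) := by
  let L : Set (CantorT × CantorT) := {w | w.2 = e w.1}
  have hL : IsClosed L := isClosed_eq (by fun_prop) (by fun_prop)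
  refine conn_of_edges (L := L) hL (fun P hP => ?_) rfl rfl ?_
  · have : P.2 = e P.1 := hP
    rw [this]; exact (he _).symm
  · have hφ : Continuous (fun z : CantorT => (z, e z)) := by fun_prop
    refine map_mem_closure (f := fun z : CantorT => (z, e z)) hφ (hmin p p') ?_
    rintro _ ⟨n, rfl⟩
    simp only [mem_ofPred_eq]
    induction n with
    | zero => exact .refl _
    | succ n ih =>
      refine .trans _ _ _ ih (.rel _ _ ⟨rfl, rfl, Or.inl ?_⟩)
      simp only [Function.iterate_succ_apply', hc]

lemma pos_conn (hap : ∀ (i : ℤ) (_ : i ≠ 0) (x : CantorT), (f ^ i) x ≠ x) (p : CantorT) (n : ℕ) :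
    Conn f (cc f (p, f p)) (cc f (p, (f ^ ((n : ℤ) + 1)) p)) := by
  induction n with
  | zero =>
    have h1 : p ≠ f p := by simpa using (hap 1 (by norm_num) p).symm
    have h2 : p ≠ f (f p) := by
      have := (hap (1 + 1) (by norm_num) p).symm
      rw [zsucc, zpow_one] at this; exact this
    have := Conn.vert h1 h2
    simpa using this.trans this.symm
  | succ n ih =>
    refine ih.trans ?_
    push_cast
    rw [zsucc ((n : ℤ) + 1)]
    refine Conn.vert (hap _ (by omega) p).symm ?_
    rw [← zsucc]
    exact (hap _ (by omega) p).symm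

lemma neg_conn (hap : ∀ (i : ℤ) (_ : i ≠ 0) (x : CantorT), (f ^ i) x ≠ x) (p : CantorT) (n : ℕ) :
    Conn f (cc f (p, (f ^ (-(n : ℤ) - 2)) p)) (cc f (p, (f ^ (-1 : ℤ)) p)) := by
  have step : ∀ n : ℕ, Conn f (cc f (p, (f ^ (-(n : ℤ) - 2)) p)) (cc f (p, (f ^ (-(n : ℤ) - 1)) p)) := by
    intro n
    rw [show -(n : ℤ) - 1 = (-(n : ℤ) - 2) + 1 by ring, zsucc]
    refine Conn.vert (hap _ (by omega) p).symm ?_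
    rw [← zsucc]
    exact (hap _ (by omega) p).symm
  induction n with
  | zero => simpa using step 0
  | succ n ih =>
    refine (step (n + 1)).trans ?_
    convert ih using 5
    push_cast; ring

lemma main (hmin : ∀ x : CantorT, Dense (Set.range fun n : ℕ => (⇑f)^[n] x))
    (hwm : ∃ z : CantorT × CantorT, Dense (Set.range fun n : ℕ => (Prod.map ⇑f ⇑f)^[n] z)) :
    ContinuumwiseConnected {w : GlueSpace ⇑f × GlueSpace ⇑f | w.1 ≠ w.2} := by
  have hap : ∀ (i : ℤ) (_ : i ≠ 0) (x : CantorT), (f ^ i) x ≠ x := aperiodic hmin hwm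
  have hfix : ∀ z, f z ≠ z := fun z => by simpa using hap 1 one_ne_zero z
  have hfix' : ∀ z, f.symm z ≠ z := fun z h => hfix z (by
    have := congrArg f h
    rw [f.apply_symm_apply] at this
    exact this.symm)
  obtain ⟨x₀, y₀, h₀⟩ := exists_off hwm
  have hneg : ∀ p, Conn f (cc f (p, f.symm p)) (cc f (x₀, f x₀)) := fun p =>
    (graph_conn hmin f.symm hfix' (fun z => by simp) p x₀).trans
      ((off_conn hmin hwm x₀ y₀ h₀).2.symm.trans (off_conn hmin hwm x₀ y₀ h₀).1)
  have hpos : ∀ p, Conn f (cc f (p, f p)) (cc f (x₀, f x₀)) := fun p =>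
    graph_conn hmin f hfix (fun z => rfl) p x₀
  have hall : ∀ p q, p ≠ q → Conn f (cc f (p, q)) (cc f (x₀, f x₀)) := by
    intro p q hpq
    by_cases hoff : ∀ k : ℤ, (f ^ k) p ≠ q
    · exact (off_conn hmin hwm p q hoff).1.trans (hpos p)
    · push Not at hoff
      obtain ⟨k, rfl⟩ := hoff
      have hk : k ≠ 0 := by rintro rfl; simp at hpq
      rcases lt_or_gt_of_ne hk with h | h
      · have hm1 : (f ^ (-1 : ℤ)) p = f.symm p := by rw [zpow_neg_one]; rfl
        by_cases h1 : k = -1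
        · subst h1; rw [hm1]; exact hneg p
        · obtain ⟨n, hn⟩ := Int.eq_ofNat_of_zero_le (show 0 ≤ -k - 2 by omega)
          obtain rfl : k = -(n : ℤ) - 2 := by omega
          have := neg_conn hap p n
          rw [hm1] at this
          exact this.trans (hneg p)
      · obtain ⟨n, hn⟩ := Int.eq_ofNat_of_zero_le (show 0 ≤ k - 1 by omega)
        obtain rfl : k = (n : ℤ) + 1 := by omega
        exact (pos_conn hap p n).symm.trans (hpos p)
  intro P hP Q hQ
  obtain ⟨p, q, hpq, hc⟩ := reduce hfix P hP
  obtain ⟨p', q', hpq', hc'⟩ := reduce hfix Q hQ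
  exact (hc.trans (hall p q hpq)).trans ((hall p' q' hpq').symm.trans hc'.symm)

end GlueAux

/-- Suppose `f : C → C` is a homeomorphism of the Cantor set all of whose orbits are dense,
all of whose inverse orbits are dense, and such that `f × f` has a dense orbit.  Then for the
quotient space `X` of `C × [0,1]` gluing `(p,1)` to `(f p, 0)`, the set `X² \ Δ` is
continuumwise connected in `X²`. -/
theorem glueSpace_compl_diagonal_continuumwiseConnected
    (f : CantorT ≃ₜ CantorT)
    (hmin : ∀ x : CantorT, Dense (Set.range fun n : ℕ => (⇑f)^[n] x))
    (hmin' : ∀ x : CantorT, Dense (Set.range fun n : ℕ => (⇑f.symm)^[n] x))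
    (hwm : ∃ z : CantorT × CantorT, Dense (Set.range fun n : ℕ => (Prod.map ⇑f ⇑f)^[n] z)) :
    ContinuumwiseConnected {w : GlueSpace ⇑f × GlueSpace ⇑f | w.1 ≠ w.2} := by
  exact GlueAux.main hmin hwm
end
end

section
/- Let X be a continuum such that the diagonal Δ has empty interior in X² and is colocally connected in X². Then X² \ Δ is continuumwise connected in X². -/
open Set

/-- If `X` is a continuum whose diagonal `Δ` has empty interior in `X²` and is colocally
connected in `X²`, then `X² \ Δ` is continuumwise connected in `X²`. -/
theorem compl_diagonal_continuumwiseConnected_of_colocallyConnected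
    {X : Type*} [MetricSpace X] [CompactSpace X] [ConnectedSpace X] [Nontrivial X]
    (hint : interior {w : X × X | w.1 = w.2} = ∅)
    (hcoloc : ∀ U : Set (X × X), IsOpen U → {w : X × X | w.1 = w.2} ⊆ U →
      ∃ V : Set (X × X), IsOpen V ∧ {w : X × X | w.1 = w.2} ⊆ V ∧ V ⊆ U ∧ IsConnected Vᶜ) :
    ContinuumwiseConnected {w : X × X | w.1 ≠ w.2} := by
  intro p hp q hq
  obtain ⟨V, hVo, hΔ, hVU, hc⟩ := hcoloc ({p, q} : Set (X × X))ᶜ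
    ((Set.toFinite _).isClosed.isOpen_compl) (by
      intro w hw hmem
      rcases hmem with h | h
      · subst h; exact hp hw
      · rw [Set.mem_singleton_iff] at h; subst h; exact hq hw)
  refine ⟨Vᶜ, hVo.isClosed_compl.isCompact, hc, ?_, ?_, ?_⟩
  · intro h; exact hVU h (by simp)
  · intro h; exact hVU h (by simp)
  · intro w hw he; exact hw (hΔ he)
end

section
/- Let X be a metric compactification of the ray [0,∞) whose remainder (the complement in X of the copy of [0,∞)) is an arc, i.e., an Elsa continuum. Then X is a decomposable continuum and X² \ Δ is not continuumwise connected in X². -/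
open Set

theorem elsa_time {X : Type*} [MetricSpace X] [CompactSpace X]
    (S : Set X) (ray : ↥(Set.Ici (0:ℝ)) ≃ₜ ↥S) (hc : IsClosed Sᶜ) :
    ∃ u : X → ℝ, Continuous u ∧ (∀ x, 0 ≤ u x) ∧ (∀ x, x ∉ S → u x = 0) ∧ (∀ x ∈ S, 0 < u x) ∧
      (∀ x ∈ S, ∀ y ∈ S, u x = u y → x = y) ∧ (∀ s, u (ray s) = 1 / (1 + (s:ℝ))) := by
  classical
  have hSo : IsOpen S := by simpa using hc.isOpen_compl
  let u : X → ℝ := fun x => if h : x ∈ S then 1 / (1 + ((ray.symm ⟨x, h⟩ : Ici (0:ℝ)) : ℝ)) else 0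
  have hray : ∀ s, u (ray s) = 1 / (1 + (s:ℝ)) := by
    intro s
    simp [u]
  have hsurj : ∀ x ∈ S, ∃ s, (ray s : X) = x := by
    intro x hx
    exact ⟨ray.symm ⟨x, hx⟩, by simp⟩
  have hJ : ∀ x, x ∉ S → u x = 0 := by
    intro x hx
    simp [u, hx]
  have hpos : ∀ x ∈ S, 0 < u x := by
    intro x hx
    obtain ⟨s, rfl⟩ := hsurj x hx
    rw [hray]
    have : (0:ℝ) ≤ s := s.2
    positivity
  have hnn : ∀ x, 0 ≤ u x := by
    intro x
    by_cases hx : x ∈ S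
    · exact (hpos x hx).le
    · exact (hJ x hx).ge
  refine ⟨u, ?_, hnn, hJ, hpos, ?_, hray⟩
  · rw [continuous_iff_continuousAt]
    intro x
    by_cases hx : x ∈ S
    · have : ContinuousOn u S := by
        rw [continuousOn_iff_continuous_domRestrict]
        have e : S.domRestrict u = fun z : S => 1 / (1 + ((ray.symm z : Ici (0:ℝ)) : ℝ)) := by
          ext z
          simp [u, Set.domRestrict]
        rw [e]
        refine Continuous.div continuous_const (by fun_prop) ?_
        intro z
        have : (0:ℝ) ≤ (ray.symm z : Ici (0:ℝ)) := (ray.symm z).2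
        positivity
      exact this.continuousAt (hSo.mem_nhds hx)
    · rw [Metric.continuousAt_iff']
      intro ε hε
      have hK : IsCompact ((fun s : Ici (0:ℝ) => (ray s : X)) '' {s | (s:ℝ) ≤ 1 / ε}) := by
        apply IsCompact.image _ (by fun_prop)
        rw [Subtype.isCompact_iff]
        convert isCompact_Icc (a := (0:ℝ)) (b := 1 / ε) using 1
        ext t
        simp [and_comm]
      have hm : ((fun s : Ici (0:ℝ) => (ray s : X)) '' {s | (s:ℝ) ≤ 1 / ε})ᶜ ∈ nhds x := by
        apply hK.isClosed.isOpen_compl.mem_nhds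
        rintro ⟨s, -, rfl⟩
        exact hx (ray s).2
      filter_upwards [hm] with y hy
      rw [hJ x hx, Real.dist_eq, sub_zero, abs_of_nonneg (hnn y)]
      by_cases hyS : y ∈ S
      · obtain ⟨s, rfl⟩ := hsurj y hyS
        rw [hray]
        have h1 : ¬ (s:ℝ) ≤ 1 / ε := fun h => hy ⟨s, h, rfl⟩
        push Not at h1
        have : (0:ℝ) ≤ s := s.2
        rw [div_lt_iff₀ hε] at h1
        rw [div_lt_iff₀ (by positivity)]
        nlinarith
      · rw [hJ y hyS]; exact hε
  · intro x hx y hy h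
    obtain ⟨s, rfl⟩ := hsurj x hx
    obtain ⟨t, rfl⟩ := hsurj y hy
    rw [hray, hray] at h
    have h1 : (1:ℝ) + s = 1 + t := by
      simpa using h
    have : s = t := Subtype.ext (by linarith)
    rw [this]

theorem elsa_decomposable_and_not_continuumwiseConnected
    {X : Type*} [MetricSpace X] [CompactSpace X] [ConnectedSpace X] [Nontrivial X]
    (S : Set X) (hS : Dense S) (ray : ↥(Set.Ici (0:ℝ)) ≃ₜ ↥S)
    (arc : ↥(Set.Icc (0:ℝ) 1) ≃ₜ ↥(Sᶜ)) :
    (∃ A B : Set X, IsCompact A ∧ IsConnected A ∧ IsCompact B ∧ IsConnected B ∧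
      A ≠ univ ∧ B ≠ univ ∧ A ∪ B = univ) ∧
    ¬ ContinuumwiseConnected {w : X × X | w.1 ≠ w.2} := by
  have hc : IsClosed Sᶜ := by
    have : CompactSpace ↥(Sᶜ) := arc.compactSpace
    exact (isCompact_iff_compactSpace.2 this).isClosed
  obtain ⟨u, hu, hnn, hJ, hpos, hinj, hray⟩ := elsa_time S ray hc
  obtain ⟨r, hr, hrr⟩ : ∃ r : ℝ → X, Continuous r ∧ ∀ s : Ici (0:ℝ), r s = ray s :=
    ⟨fun t => (ray ⟨max t 0, le_max_right t 0⟩ : X), by fun_prop, fun s => by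
      have h : (⟨max (s:ℝ) 0, le_max_right (s:ℝ) 0⟩ : Ici (0:ℝ)) = s :=
        Subtype.ext (max_eq_left s.2)
      simp only [h]⟩
  have hur : ∀ t : ℝ, 0 ≤ t → u (r t) = 1 / (1 + t) := by
    intro t ht
    have := hrr ⟨t, ht⟩
    simp only at this
    rw [this, hray]
  have hrS : ∀ t : ℝ, 0 ≤ t → r t ∈ S := by
    intro t ht
    have := hrr ⟨t, ht⟩
    simp only at this
    rw [this]
    exact (ray _).2
  obtain ⟨z0, hz0e⟩ : ∃ z : ℝ, z = 0 := ⟨_, rfl⟩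
  obtain ⟨z1, hz1e⟩ : ∃ z : ℝ, z = 1 := ⟨_, rfl⟩
  have hz0 : u (r z0) = 1 := by rw [hur z0 hz0e.ge, hz0e]; norm_num
  have hz1 : u (r z1) = 1 / 2 := by rw [hur z1 (by linarith), hz1e]; norm_num
  refine ⟨⟨r '' Icc z0 z1, closure (r '' Ici z1), ?_, ?_, ?_, ?_, ?_, ?_, ?_⟩, ?_⟩
  · exact isCompact_Icc.image hr
  · exact (isConnected_Icc (by linarith)).image _ hr.continuousOn
  · exact isClosed_closure.isCompact
  · exact (isConnected_Ici.image _ hr.continuousOn).closure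
  · intro h
    have := h.symm ▸ mem_univ (arc ⟨0, by simp⟩ : X)
    obtain ⟨s, hs0, hs⟩ := this
    exact (arc ⟨0, by simp⟩).2 (hs ▸ hrS s (hz0e ▸ hs0.1))
  · intro h
    have h1 : closure (r '' Ici z1) ⊆ {x | u x ≤ 1 / 2} := by
      apply closure_minimal _ (isClosed_le hu continuous_const)
      rintro _ ⟨s, hs, rfl⟩
      have hs' : (1:ℝ) ≤ s := hz1e ▸ hs
      rw [mem_ofPred_eq, hur s (by linarith)]
      apply one_div_le_one_div_of_le <;> linarith
    have h2 := h1 (h.symm ▸ mem_univ (r z0))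
    simp only [mem_ofPred_eq, hz0] at h2
    norm_num at h2
  · have hcl : IsClosed (r '' Icc z0 z1 ∪ closure (r '' Ici z1)) :=
      (isCompact_Icc.image hr).isClosed.union isClosed_closure
    rw [← univ_subset_iff, ← hS.closure_eq]
    apply closure_minimal _ hcl
    intro x hx
    obtain ⟨s, hs, rfl⟩ : ∃ s, 0 ≤ s ∧ r s = x :=
      ⟨ray.symm ⟨x, hx⟩, (ray.symm ⟨x, hx⟩).2, by simp [hrr]⟩
    rcases le_total s z1 with h | h
    · exact Or.inl ⟨s, ⟨hz0e ▸ hs, h⟩, rfl⟩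
    · exact Or.inr (subset_closure ⟨s, h, rfl⟩)
  · intro H
    have hne : r z0 ≠ r z1 := by
      intro h
      rw [h, hz1] at hz0
      norm_num at hz0
    obtain ⟨M, hMc, hMconn, hp, hq, hM⟩ := H (r z0, r z1) hne (r z1, r z0) hne.symm
    obtain ⟨g, hg⟩ := ContinuousMap.exists_restrict_eq (Y := Icc (0:ℝ) 1) hc
      ⟨arc.symm, arc.symm.continuous⟩
    have hgJ : ∀ x : ↥(Sᶜ), g x = arc.symm x := fun x => DFunLike.congr_fun hg x
    let G : X → ℝ := fun x => g x
    have hG : Continuous G := by fun_prop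
    have hG0 : ∀ x, 0 ≤ G x := fun x => (g x).2.1
    have hG1 : ∀ x, G x ≤ 1 := fun x => (g x).2.2
    have hGarc : ∀ t, G (arc t) = t := by
      intro t
      simp [G, hgJ]
    have hGinj : ∀ x ∉ S, ∀ y ∉ S, G x = G y → x = y := by
      intro x hx y hy h
      have h' : g x = g y := Subtype.ext h
      have e1 := hgJ ⟨x, hx⟩
      have e2 := hgJ ⟨y, hy⟩
      have := arc.symm.injective (e1.symm.trans (h'.trans e2))
      exact congrArg Subtype.val this
    obtain ⟨m, hm, hmin⟩ := hMc.exists_isMinOn ⟨_, hp⟩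
      (f := fun w : X × X => |G w.1 - G w.2| + u w.1 + u w.2) (by fun_prop)
    have hmpos : 0 < |G m.1 - G m.2| + u m.1 + u m.2 := by
      by_contra hcon
      have a1 := abs_nonneg (G m.1 - G m.2)
      have a2 := hnn m.1
      have a3 := hnn m.2
      have b2 : u m.1 = 0 := by linarith
      have b3 : u m.2 = 0 := by linarith
      have b1 : |G m.1 - G m.2| = 0 := by linarith
      refine hM hm (hGinj _ (fun h => (hpos _ h).ne' b2) _ (fun h => (hpos _ h).ne' b3) ?_)
      exact sub_eq_zero.1 (abs_eq_zero.1 b1)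
    obtain ⟨η, hη, hη'⟩ : ∃ η > 0, |G m.1 - G m.2| + u m.1 + u m.2 = 3 * η :=
      ⟨_, div_pos hmpos three_pos, by ring⟩
    have key : ∀ w ∈ M, u w.1 < η → u w.2 < η → η < |G w.1 - G w.2| := by
      intro w hw h1 h2
      have := hmin hw
      simp only [mem_ofPred_eq] at this
      linarith
    have key2 : ∀ w ∈ M, u w.1 = u w.2 → u w.1 = 0 := by
      intro w hw h
      by_contra h0
      have m1 : w.1 ∈ S := by
        by_contra h'
        exact h0 (hJ _ h')
      have m2 : w.2 ∈ S := by
        by_contra h'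
        exact h0 (h.trans (hJ _ h'))
      exact hM hw (hinj _ m1 _ m2 h)
    have uarc : ∀ t, u (arc t) = 0 := fun t => hJ _ (arc t).2
    obtain ⟨a, ⟨⟨ha1, ha2⟩, ha3⟩, haS⟩ := hS.inter_open_nonempty
      (({x | u x < η} ∩ {x | u x < 1}) ∩ {x | G x < η})
      (((isOpen_lt hu continuous_const).inter (isOpen_lt hu continuous_const)).inter
        (isOpen_lt hG continuous_const))
      ⟨arc ⟨0, by simp⟩, by simp [uarc, hGarc, hη]⟩
    obtain ⟨b, ⟨hb1, hb2⟩, hbS⟩ := hS.inter_open_nonempty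
      ({x | u x < u a} ∩ {x | 1 - η < G x})
      ((isOpen_lt hu continuous_const).inter (isOpen_lt continuous_const hG))
      ⟨arc ⟨1, by simp⟩, by simp [uarc, hGarc, hη, hpos a haS]⟩
    simp only [mem_ofPred_eq] at ha1 ha2 ha3 hb1 hb2
    have hbpos := hpos b hbS
    have haeq : ∀ x, u x = u a → x = a := by
      intro x hx
      refine hinj x ?_ a haS hx
      by_contra h
      rw [hJ x h] at hx
      linarith
    have hbeq : ∀ x, u x = u b → x = b := by
      intro x hx
      refine hinj x ?_ b hbS hx
      by_contra h
      rw [hJ x h] at hx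
      linarith
    let U : Set (X × X) := {w | u b < u w.1} ∩ ({w | u w.2 < u w.1} ∩
      ({w | u a < u w.1} ∪ {w | G w.1 < G w.2}))
    let C : Set (X × X) := {w | u b ≤ u w.1} ∩ ({w | u w.2 ≤ u w.1} ∩
      ({w | u a ≤ u w.1} ∪ {w | G w.1 ≤ G w.2}))
    have hU : IsOpen U := by
      refine (isOpen_lt ?_ ?_).inter ((isOpen_lt ?_ ?_).inter
        ((isOpen_lt ?_ ?_).union (isOpen_lt ?_ ?_))) <;> fun_prop
    have hC : IsClosed C := by
      refine (isClosed_le ?_ ?_).inter ((isClosed_le ?_ ?_).inter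
        ((isClosed_le ?_ ?_).union (isClosed_le ?_ ?_))) <;> fun_prop
    have hUC : U ⊆ C := by
      rintro w ⟨h1, h2, h3⟩
      simp only [mem_ofPred_eq, mem_union] at h1 h2 h3
      simp only [C, mem_inter_iff, mem_ofPred_eq, mem_union]
      exact ⟨h1.le, h2.le, h3.imp le_of_lt le_of_lt⟩
    have hCU : ∀ w ∈ M, w ∈ C → w ∈ U := by
      rintro w hw ⟨h1, h2, h3⟩
      simp only [mem_ofPred_eq, mem_union] at h1 h2 h3
      have h2' : u w.2 < u w.1 := by
        refine lt_of_le_of_ne h2 fun h => ?_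
        have := key2 w hw h.symm
        linarith
      have h3' : u a < u w.1 ∨ G w.1 < G w.2 := by
        rcases lt_or_ge (u a) (u w.1) with h | h
        · exact Or.inl h
        · right
          have k := key w hw (by linarith) (by linarith)
          rcases h3 with h3 | h3
          · have e : w.1 = a := haeq _ (le_antisymm h h3)
            rw [e] at k ⊢
            have := hG0 w.2
            rcases lt_abs.1 k with k | k <;> linarith
          · refine lt_of_le_of_ne h3 fun h => ?_
            rw [h, sub_self, abs_zero] at k
            linarith
      refine ⟨lt_of_le_of_ne h1 fun h => ?_, h2', h3'⟩
      have k := key w hw (by linarith) (by linarith)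
      have e := hbeq _ h.symm
      rcases h3' with h3 | h3
      · linarith
      · have := hG1 w.2
        rw [e] at k h3
        rcases lt_abs.1 k with k | k <;> linarith
    obtain ⟨w, -, hwU, hwC⟩ := hMconn.isPreconnected U Cᶜ hU hC.isOpen_compl
      (fun w hw => by
        by_cases h : w ∈ C
        · exact Or.inl (hCU w hw h)
        · exact Or.inr h)
      ⟨_, hp, by
        refine ⟨?_, ?_, Or.inl ?_⟩ <;> simp only [mem_ofPred_eq, hz0, hz1] <;> linarith⟩
      ⟨_, hq, by
        rintro ⟨-, h, -⟩
        simp only [mem_ofPred_eq, hz0, hz1] at h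
        norm_num at h⟩
    exact hwC (hUC hwU)
end

section
/- Let X be a metric compactification of the ray [0,∞) whose remainder R is nondegenerate (has more than one point). Then X is arc-like if and only if R is an arc-like continuum. -/
open Set

lemma exists_eps_map_of_fibers {Y : Type*} [MetricSpace Y] [CompactSpace Y] [ConnectedSpace Y]
    (h : Y → ℝ) (hc : Continuous h) (a b : Y) (hab : h a ≠ h b) (δ ε : ℝ) (hδ : 0 ≤ δ)
    (hδε : δ < ε) (hf : ∀ x y, h x = h y → dist x y ≤ δ) :
    ∃ g : Y → Set.Icc (0:ℝ) 1, IsEpsilonMap ε g := by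
  obtain ⟨p, -, hp⟩ := isCompact_univ.exists_isMinOn (univ_nonempty (α := Y)) hc.continuousOn
  obtain ⟨q, -, hq⟩ := isCompact_univ.exists_isMaxOn (univ_nonempty (α := Y)) hc.continuousOn
  have hp' : ∀ x, h p ≤ h x := fun x => hp (mem_univ x)
  have hq' : ∀ x, h x ≤ h q := fun x => hq (mem_univ x)
  have hpq : 0 < h q - h p := by
    rcases lt_or_gt_of_ne hab with H | H
    · linarith [hp' a, hq' b]
    · linarith [hp' b, hq' a]
  refine ⟨fun x => ⟨(h x - h p) / (h q - h p), ?_, ?_⟩, ?_, ?_, ?_⟩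
  · exact div_nonneg (by linarith [hp' x]) hpq.le
  · rw [div_le_one hpq]; linarith [hq' x]
  · exact Continuous.subtype_mk ((hc.sub continuous_const).div_const _) _
  · rintro ⟨y, hy0, hy1⟩
    have : h p + y * (h q - h p) ∈ range h := by
      apply mem_range_of_exists_le_of_exists_ge hc
      · exact ⟨p, by nlinarith⟩
      · exact ⟨q, by nlinarith⟩
    obtain ⟨x, hx⟩ := this
    refine ⟨x, Subtype.ext ?_⟩
    simp only [hx]
    field_simp
    ring
  · intro y
    refine lt_of_le_of_lt (Metric.diam_le_of_forall_dist_le hδ ?_) hδε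
    intro x hx z hz
    apply hf
    have := hx.trans hz.symm
    have h2 := congrArg Subtype.val this
    simp only at h2
    rw [div_left_inj' hpq.ne'] at h2
    linarith

lemma exists_ray_param {X : Type*} [MetricSpace X] (S : Set X)
    (ray : ↥(Set.Ici (0:ℝ)) ≃ₜ ↥S) : ∃ T : X → ℝ, (∀ x ∈ S, 0 ≤ T x) ∧ ContinuousOn T S ∧
      InjOn T S ∧ (∀ t, 0 ≤ t → ∃ x ∈ S, T x = t) ∧ (∀ N, IsCompact {x | x ∈ S ∧ T x ≤ N}) ∧
      (∀ N, 0 ≤ N → IsPreconnected {x | x ∈ S ∧ N < T x}) := by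
  classical
  set T : X → ℝ := fun x => if h : x ∈ S then (ray.symm ⟨x, h⟩ : ℝ) else 0 with hT
  have hTS : ∀ x (h : x ∈ S), T x = ray.symm ⟨x, h⟩ := fun x h => by simp [hT, h]
  have hr : ∀ t, T (ray t) = t := fun t => by rw [hTS _ (ray t).2]; simp
  have hcr : Continuous fun t => (ray t : X) := continuous_subtype_val.comp ray.continuous
  have himg : ∀ p : ℝ → Prop, {x | x ∈ S ∧ p (T x)} = (fun t => (ray t : X)) '' {t | p t} := by
    intro p
    ext x
    constructor
    · rintro ⟨h1, h2⟩
      refine ⟨ray.symm ⟨x, h1⟩, ?_, by simp⟩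
      rw [hTS x h1] at h2
      exact h2
    · rintro ⟨t, h1, rfl⟩
      refine ⟨(ray t).2, ?_⟩
      rw [hr]; exact h1
  refine ⟨T, ?_, ?_, ?_, ?_, ?_, ?_⟩
  · intro x hx; rw [hTS x hx]; exact (ray.symm ⟨x, hx⟩).2
  · rw [continuousOn_iff_continuous_domRestrict]
    have : S.domRestrict T = fun x => (ray.symm x : ℝ) := by
      ext x; exact hTS x x.2
    rw [this]
    exact continuous_subtype_val.comp ray.symm.continuous
  · intro x hx y hy hxy
    rw [hTS x hx, hTS y hy] at hxy
    have := ray.symm.injective (Subtype.ext hxy)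
    exact congrArg Subtype.val this
  · intro t ht
    exact ⟨ray ⟨t, ht⟩, (ray _).2, hr _⟩
  · intro N
    rw [himg (fun s => s ≤ N)]
    refine IsCompact.image ?_ hcr
    rw [Topology.IsEmbedding.subtypeVal.isCompact_iff]
    convert isCompact_Icc (a := (0:ℝ)) (b := N) using 1
    ext s; simp [and_comm]
  · intro N hN
    rw [himg (fun s => N < s)]
    refine IsPreconnected.image ?_ _ hcr.continuousOn
    rw [← Topology.IsInducing.subtypeVal.isPreconnected_image]
    convert isPreconnected_Ioi (a := N) using 1
    ext s
    simp only [mem_image, mem_ofPred_eq, Subtype.exists, mem_Ici, mem_Ioi]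
    constructor
    · rintro ⟨a, _, h, rfl⟩; exact h
    · intro h; exact ⟨s, by linarith, h, rfl⟩

lemma bounded_of_compact {X : Type*} [MetricSpace X] {S : Set X} {T : X → ℝ}
    (hT : ContinuousOn T S) {C : Set X} (hC : IsCompact C) (hCS : C ⊆ S) :
    ∃ N, 0 ≤ N ∧ ∀ x ∈ C, T x ≤ N := by
  obtain ⟨N, hN⟩ := (hC.image_of_continuousOn (hT.mono hCS)).bddAbove
  exact ⟨max N 0, le_max_right _ _, fun x hx =>
    (hN (mem_image_of_mem _ hx)).trans (le_max_left _ _)⟩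

lemma dense_tail {X : Type*} [MetricSpace X] {S : Set X} (hS : Dense S) {T : X → ℝ}
    (hcpt : ∀ N, IsCompact {x | x ∈ S ∧ T x ≤ N}) (N : ℝ) {U : Set X} (hU : IsOpen U)
    {p : X} (hpU : p ∈ U) (hp : p ∈ Sᶜ) : ∃ x ∈ U, x ∈ S ∧ N < T x := by
  obtain ⟨x, ⟨hx1, hx2⟩, hx3⟩ := hS.inter_open_nonempty (U ∩ {x | x ∈ S ∧ T x ≤ N}ᶜ)
    (hU.inter (hcpt N).isClosed.isOpen_compl) ⟨p, hpU, fun h => hp h.1⟩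
  refine ⟨x, hx1, hx3, ?_⟩
  by_contra h
  exact hx2 ⟨hx3, not_lt.1 h⟩

lemma ray_isOpen {X : Type*} [MetricSpace X] {S : Set X} (hS : Dense S) {T : X → ℝ}
    (hT : ContinuousOn T S) (hcpt : ∀ N, IsCompact {x | x ∈ S ∧ T x ≤ N}) : IsOpen S := by
  rw [isOpen_iff_mem_nhds]
  intro x hx
  -- a neighbourhood of `x` in which points of `S` have bounded parameter
  have h1 : {y | T y < T x + 1} ∈ nhdsWithin x S :=
    (hT x hx) (Iio_mem_nhds (by linarith))
  obtain ⟨U, hU, hxU, hUS⟩ := mem_nhdsWithin.1 h1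
  refine Filter.mem_of_superset (hU.mem_nhds hxU) ?_
  intro y hy
  by_contra hyS
  obtain ⟨z, hz, hzS, hzT⟩ := dense_tail hS hcpt (T x + 1) hU hy hyS
  have : T z < T x + 1 := hUS ⟨hz, hzS⟩
  linarith

lemma remainder_isPreconnected {X : Type*} [MetricSpace X] [CompactSpace X] {S : Set X}
    (hS : Dense S) {T : X → ℝ}
    (hT : ContinuousOn T S) (hcpt : ∀ N, IsCompact {x | x ∈ S ∧ T x ≤ N})
    (hconn : ∀ N, 0 ≤ N → IsPreconnected {x | x ∈ S ∧ N < T x}) : IsPreconnected Sᶜ := by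
  have hcl : IsClosed Sᶜ := (ray_isOpen hS hT hcpt).isClosed_compl
  rw [isPreconnected_iff_subset_of_fully_disjoint_closed hcl]
  intro A B hA hB hAB hd
  obtain ⟨U, V, hU, hV, hAU, hBV, hUV⟩ := normal_separation hA hB hd
  have hC : IsCompact (U ∪ V)ᶜ := (hU.union hV).isClosed_compl.isCompact
  have hCS : (U ∪ V)ᶜ ⊆ S := by
    intro x hx
    by_contra h
    rcases hAB h with h | h
    · exact hx (Or.inl (hAU h))
    · exact hx (Or.inr (hBV h))
  obtain ⟨N, hN0, hN⟩ := bounded_of_compact hT hC hCS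
  have hsub : {x | x ∈ S ∧ N < T x} ⊆ U ∪ V := by
    rintro x ⟨_, hx⟩
    by_contra h
    linarith [hN x h]
  rcases (hconn N hN0).subset_or_subset hU hV hUV hsub with h | h
  · left
    intro x hx
    rcases hAB hx with h1 | h1
    · exact h1
    · obtain ⟨z, hz, hz2⟩ := dense_tail hS hcpt N hV (hBV h1) hx
      exact (disjoint_left.1 hUV (h hz2) hz).elim
  · right
    intro x hx
    rcases hAB hx with h1 | h1
    · obtain ⟨z, hz, hz2⟩ := dense_tail hS hcpt N hU (hAU h1) hx
      exact (disjoint_left.1 hUV hz (h hz2)).elim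
    · exact h1

lemma exists_eta {X : Type*} [MetricSpace X] [CompactSpace X] {R : Set X} (hR : IsClosed R)
    (hne : R.Nonempty) (F : X → ℝ) (hF : Continuous F) (ε : ℝ)
    (h : ∀ x ∈ R, ∀ y ∈ R, F x = F y → dist x y < ε) :
    ∃ η > 0, ∀ x y, Metric.infDist x R < η → Metric.infDist y R < η → |F x - F y| < η →
      dist x y < ε := by
  set φ : X × X → ℝ := fun z => |F z.1 - F z.2| + Metric.infDist z.1 R + Metric.infDist z.2 R
  have hφ : Continuous φ := by
    have := Metric.continuous_infDist_pt R
    fun_prop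
  have hC : IsCompact {z : X × X | ε ≤ dist z.1 z.2} :=
    (isClosed_le continuous_const (by fun_prop)).isCompact
  rcases eq_empty_or_nonempty {z : X × X | ε ≤ dist z.1 z.2} with he | he
  · refine ⟨1, one_pos, fun x y _ _ _ => ?_⟩
    by_contra hxy
    have : (x, y) ∈ {z : X × X | ε ≤ dist z.1 z.2} := not_lt.1 hxy
    rw [he] at this
    exact this
  · obtain ⟨z, hz, hmin⟩ := hC.exists_isMinOn he hφ.continuousOn
    have h1 : 0 ≤ |F z.1 - F z.2| := abs_nonneg _
    have h2 : 0 ≤ Metric.infDist z.1 R := Metric.infDist_nonneg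
    have h3 : 0 ≤ Metric.infDist z.2 R := Metric.infDist_nonneg
    have hpos : 0 < φ z := by
      by_contra hn
      have hn' : |F z.1 - F z.2| + Metric.infDist z.1 R + Metric.infDist z.2 R ≤ 0 := not_lt.1 hn
      have e1 : z.1 ∈ R := (hR.mem_iff_infDist_zero hne).2 (by linarith)
      have e2 : z.2 ∈ R := (hR.mem_iff_infDist_zero hne).2 (by linarith)
      have e3 : F z.1 - F z.2 = 0 := abs_eq_zero.1 (by linarith)
      have := h _ e1 _ e2 (by linarith)
      have hz' : ε ≤ dist z.1 z.2 := hz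
      linarith
    refine ⟨φ z / 3, by positivity, fun x y hx hy hxy => ?_⟩
    by_contra hn
    have : φ z ≤ φ (x, y) := hmin (not_lt.1 hn : (x, y) ∈ {z : X × X | ε ≤ dist z.1 z.2})
    have h4 : φ (x, y) = |F x - F y| + Metric.infDist x R + Metric.infDist y R := rfl
    linarith

/-- Let `X` be a metric compactification of the ray `[0,∞)` (a continuum containing a dense
homeomorphic copy `S` of `[0,∞)`) whose remainder `R = Sᶜ` has more than one point.  Then
`X` is arc-like if and only if the remainder `R` is an arc-like continuum (a compact,
connected, arc-like space). -/
theorem compactification_arcLike_iff_remainder_arcLike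
    {X : Type*} [MetricSpace X] [CompactSpace X] [ConnectedSpace X] [Nontrivial X]
    (S : Set X) (hS : Dense S) (ray : ↥(Set.Ici (0:ℝ)) ≃ₜ ↥S)
    (hnd : ∃ a ∈ Sᶜ, ∃ b ∈ Sᶜ, a ≠ b) :
    ArcLike X ↔ (CompactSpace ↥(Sᶜ) ∧ ConnectedSpace ↥(Sᶜ) ∧ ArcLike ↥(Sᶜ)) := by
  obtain ⟨T, hT0, hTc, hTinj, hTsurj, hTcpt, hTconn⟩ := exists_ray_param S ray
  have hSo : IsOpen S := ray_isOpen hS hTc hTcpt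
  have hR : IsClosed Sᶜ := hSo.isClosed_compl
  obtain ⟨a, ha, b, hb, hab⟩ := hnd
  have hRne : (Sᶜ : Set X).Nonempty := ⟨a, ha⟩
  constructor
  · intro hX
    have i1 : CompactSpace ↥(Sᶜ) := isCompact_iff_compactSpace.1 hR.isCompact
    have i2 : ConnectedSpace ↥(Sᶜ) :=
      isConnected_iff_connectedSpace.1 ⟨hRne, remainder_isPreconnected hS hTc hTcpt hTconn⟩
    refine ⟨i1, i2, ?_⟩
    intro ε hε
    have hd : 0 < dist a b := dist_pos.2 hab
    obtain ⟨g, hgc, -, hgd⟩ := hX (min (ε / 2) (dist a b)) (lt_min (by linarith) hd)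
    have key : ∀ x y, g x = g y → dist x y < min (ε / 2) (dist a b) := by
      intro x y hxy
      refine lt_of_le_of_lt (Metric.dist_le_diam_of_mem ?_ ?_ ?_) (hgd (g y))
      · exact (Metric.isBounded_of_compactSpace)
      · exact hxy
      · rfl
    refine exists_eps_map_of_fibers (fun x : ↥(Sᶜ) => (g x : ℝ)) (by fun_prop) ⟨a, ha⟩ ⟨b, hb⟩
      ?_ (ε / 2) ε (by linarith) (by linarith) ?_
    · intro h
      exact absurd (key a b (Subtype.ext h)) (not_lt.2 (min_le_right _ _))
    · intro x y h
      exact ((key x y (Subtype.ext h)).trans_le (min_le_left _ _)).le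
  · rintro ⟨i1, i2, hA⟩ ε hε
    obtain ⟨f, hfc, hfs, hfd⟩ := hA (ε / 2) (by linarith)
    obtain ⟨F0, hF0⟩ := ContinuousMap.exists_restrict_eq hR
      (⟨fun x => (f x : ℝ), by fun_prop⟩ : C(↥(Sᶜ), ℝ))
    set F : X → ℝ := fun x => max (F0 x) 0 with hFdef
    have hFc : Continuous F := F0.continuous.max continuous_const
    have hF0' : ∀ x, 0 ≤ F x := fun x => le_max_right _ _
    have hFf : ∀ x (hx : x ∈ Sᶜ), F x = f ⟨x, hx⟩ := by
      intro x hx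
      have h1 : F0 x = f ⟨x, hx⟩ := congrArg (fun k : C(↥(Sᶜ), ℝ) => k ⟨x, hx⟩) hF0
      have h2 : F x = max (F0 x) 0 := rfl
      rw [h2, h1, max_eq_left (f ⟨x, hx⟩).2.1]
    have hfib : ∀ x ∈ Sᶜ, ∀ y ∈ Sᶜ, F x = F y → dist x y < ε / 2 := by
      intro x hx y hy hxy
      rw [hFf x hx, hFf y hy] at hxy
      have := Subtype.ext hxy
      have h2 : dist (⟨x, hx⟩ : ↥(Sᶜ)) ⟨y, hy⟩ < ε / 2 := by
        refine lt_of_le_of_lt (Metric.dist_le_diam_of_mem ?_ ?_ ?_) (hfd (f ⟨y, hy⟩))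
        · exact (Metric.isBounded_of_compactSpace)
        · exact this
        · rfl
      exact h2
    obtain ⟨η, hη, hclose⟩ := exists_eta hR hRne F hFc (ε / 2) hfib
    have hCc : IsCompact {x : X | η ≤ Metric.infDist x Sᶜ} :=
      (isClosed_le continuous_const (Metric.continuous_infDist_pt _)).isCompact
    obtain ⟨N, hN0, hN⟩ := bounded_of_compact hTc hCc (by
      intro x hx
      by_contra h
      have h0 : Metric.infDist x Sᶜ = 0 := Metric.infDist_zero_of_mem h
      have : η ≤ Metric.infDist x Sᶜ := hx
      linarith)
    -- near the end
    obtain ⟨⟨p, hp⟩, hfp⟩ := hfs ⟨0, by simp⟩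
    have hFp : F p = 0 := by rw [hFf p hp, hfp]
    obtain ⟨q, hqη, hqS, hqN⟩ := dense_tail hS hTcpt N
      (isOpen_lt hFc continuous_const : IsOpen {x | F x < η / 2}) (p := p)
      (by change F p < η / 2; rw [hFp]; linarith) hp
    have hqη' : F q < η / 2 := hqη
    classical
    set W : Set X := {x | x ∈ S ∧ T x < T q} with hW
    have hWo : IsOpen W := hTc.isOpen_inter_preimage hSo isOpen_Iio
    set G : X → ℝ := fun x => if x ∈ W then T x - T q else max (F x - F q) 0 with hG
    have hG1 : ∀ x, x ∈ W → G x = T x - T q := fun x hx => by simp only [hG, if_pos hx]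
    have hG2 : ∀ x, x ∉ W → G x = max (F x - F q) 0 := fun x hx => by simp only [hG, if_neg hx]
    have hW1 : ∀ x, x ∈ W → G x < 0 := by
      intro x hx
      rw [hG1 x hx]
      linarith [hx.2]
    have hW2 : ∀ x, x ∉ W → 0 ≤ G x := fun x hx => by rw [hG2 x hx]; exact le_max_right _ _
    have hGc : Continuous G := by
      rw [← continuousOn_univ]
      have hu : (univ : Set X) = {x | x ∈ S ∧ T x ≤ T q} ∪ Wᶜ := by
        ext x
        simp only [mem_univ, true_iff]
        by_cases hx : x ∈ W
        · exact Or.inl ⟨hx.1, hx.2.le⟩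
        · exact Or.inr hx
      rw [hu]
      refine ContinuousOn.union_of_isClosed ?_ ?_ (hTcpt _).isClosed hWo.isClosed_compl
      · have h1 : ContinuousOn (fun x => T x - T q) {x | x ∈ S ∧ T x ≤ T q} :=
          (hTc.mono fun x hx => hx.1).sub continuousOn_const
        refine h1.congr ?_
        rintro x ⟨hxS, hx⟩
        by_cases hxW : x ∈ W
        · exact hG1 x hxW
        · have hTe : T x = T q := le_antisymm hx (not_lt.1 fun h => hxW ⟨hxS, h⟩)
          have hxq : x = q := hTinj hxS hqS hTe
          rw [hG2 x hxW, hxq]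
          simp
      · have h1 : Continuous (fun x => max (F x - F q) 0) :=
          (hFc.sub continuous_const).max continuous_const
        exact h1.continuousOn.congr fun x hx => hG2 x hx
    have hnear : ∀ x, x ∉ W → Metric.infDist x Sᶜ < η := by
      intro x hx
      by_contra h
      have h1 : η ≤ Metric.infDist x Sᶜ := not_lt.1 h
      have hxS : x ∈ S := by
        by_contra h2
        have : Metric.infDist x Sᶜ = 0 := Metric.infDist_zero_of_mem h2
        linarith
      exact hx ⟨hxS, lt_of_le_of_lt (hN x h1) hqN⟩
    obtain ⟨o, hoS, ho⟩ := hTsurj 0 le_rfl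
    have hoW : o ∈ W := ⟨hoS, by rw [ho]; linarith⟩
    have hqW : q ∉ W := fun h => lt_irrefl _ h.2
    refine exists_eps_map_of_fibers G hGc o q ?_ (ε / 2) ε (by linarith) (by linarith) ?_
    · intro h
      linarith [hW1 o hoW, hW2 q hqW]
    · intro x y hxy
      by_cases hx : x ∈ W
      · by_cases hy : y ∈ W
        · rw [hG1 x hx, hG1 y hy] at hxy
          have : x = y := hTinj hx.1 hy.1 (by linarith)
          rw [this, dist_self]
          linarith
        · linarith [hW1 x hx, hW2 y hy]
      · by_cases hy : y ∈ W
        · linarith [hW1 y hy, hW2 x hx]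
        · refine (hclose x y (hnear x hx) (hnear y hy) ?_).le
          rw [hG2 x hx, hG2 y hy] at hxy
          have p1 := hF0' x
          have p2 := hF0' y
          rw [abs_lt]
          rcases max_cases (F x - F q) 0 with ⟨e1, _⟩ | ⟨e1, _⟩ <;>
          rcases max_cases (F y - F q) 0 with ⟨e2, _⟩ | ⟨e2, _⟩ <;>
          rw [e1, e2] at hxy <;> constructor <;> linarith
end

section
/- Let f : C → C be a homeomorphism of the Cantor ternary set and fix δ with 0 < δ < 1/10. Define V₁ = {((p,s),(q,t)) ∈ (C×[0,1])² : |p−q| < δ and |t−s| < δ}, V₂ = {((p,s),(q,t)) ∈ (C×[0,1])² : |p−f(q)| < δ, s < δ and 1−δ < t}, V₃ = {((p,s),(q,t)) ∈ (C×[0,1])² : |f(p)−q| < δ, t < δ and 1−δ < s}, V₀ = V₁ ∪ V₂ ∪ V₃, and K = (C×[0,1])² \ V₀. If z = ((p,s),(q,t)) ∈ K and s ≤ t, then there exists a nonempty compact connected subset A of (C×[0,1])² with A ⊆ K such that z ∈ A and ((p,0),(q,1/2)) ∈ A. -/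
open Set

noncomputable section

/-- `V₁ = {((p,s),(q,t)) : |p−q| < δ and |t−s| < δ}`. -/
def V1 (δ : ℝ) : Set (CI × CI) :=
  {z | |(z.1.1 : ℝ) - (z.2.1 : ℝ)| < δ ∧ |(z.2.2 : ℝ) - (z.1.2 : ℝ)| < δ}

/-- `V₂ = {((p,s),(q,t)) : |p−f(q)| < δ, s < δ and 1−δ < t}`. -/
def V2 (f : CantorT → CantorT) (δ : ℝ) : Set (CI × CI) :=
  {z | |(z.1.1 : ℝ) - (f z.2.1 : ℝ)| < δ ∧ (z.1.2 : ℝ) < δ ∧ 1 - δ < (z.2.2 : ℝ)}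

/-- `V₃ = {((p,s),(q,t)) : |f(p)−q| < δ, t < δ and 1−δ < s}`. -/
def V3 (f : CantorT → CantorT) (δ : ℝ) : Set (CI × CI) :=
  {z | |(f z.1.1 : ℝ) - (z.2.1 : ℝ)| < δ ∧ (z.2.2 : ℝ) < δ ∧ 1 - δ < (z.1.2 : ℝ)}

/-- `V₀ = V₁ ∪ V₂ ∪ V₃`. -/
def V0 (f : CantorT → CantorT) (δ : ℝ) : Set (CI × CI) := V1 δ ∪ V2 f δ ∪ V3 f δ

/-- `K = (C×[0,1])² \ V₀`. -/
def Kset (f : CantorT → CantorT) (δ : ℝ) : Set (CI × CI) := (V0 f δ)ᶜ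

theorem joined_aux {S : Set (CI × CI)} (F : ℝ → CI × CI) (hF : Continuous F) (a b : ℝ)
    (h : ∀ x, min a b ≤ x → x ≤ max a b → F x ∈ S) : JoinedIn S (F a) (F b) := by
  have h1 : JoinedIn (Set.uIcc a b) a b :=
    ((convex_uIcc a b).isPathConnected ⟨a, Set.left_mem_uIcc⟩).joinedIn a Set.left_mem_uIcc b
      Set.right_mem_uIcc
  obtain ⟨γ, hγ⟩ := h1
  exact ⟨γ.map hF, fun t => h _ (hγ t).1 (hγ t).2⟩

set_option maxHeartbeats 1600000 in
theorem joined_main {S : Set (CI × CI)} (P Q : Prop) (G : ℝ → ℝ → CI × CI) (δ : ℝ)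
    (hδ : 0 < δ) (hδ' : 10 * δ < 1) (u v : ℝ) (hu : 2 * u = 1) (hv : 5 * v = 4) (s t : ℝ) (hs0 : 0 ≤ s) (hst : s ≤ t) (ht1 : t ≤ 1)
    (h1 : P → δ ≤ t - s) (h2 : Q → s < δ → t ≤ 1 - δ)
    (c1 : ∀ b, Continuous fun a => G a b) (c2 : ∀ a, Continuous fun b => G a b)
    (hG : ∀ a b, 0 ≤ a → a ≤ b → b ≤ 1 → (P → δ ≤ b - a) → (Q → a < δ → b ≤ 1 - δ) → G a b ∈ S) :
    JoinedIn S (G s t) (G 0 u) := by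
  have j1 : JoinedIn (S) (G s t) (G (min s u) t) := by
    refine joined_aux (fun a => G a t) (c1 t) s _ fun x hx hx' => hG _ _ ?_ ?_ ?_ ?_ ?_ <;> clear hG c1 c2 <;> (try clear j1) <;> (try clear j2) <;> (try clear j3) <;> grind
  have j2 : JoinedIn (S) (G (min s u) t) (G (min s u) (min t v)) := by
    refine joined_aux (fun b => G _ b) (c2 _) t _ fun x hx hx' => hG _ _ ?_ ?_ ?_ ?_ ?_ <;> clear hG c1 c2 <;> (try clear j1) <;> (try clear j2) <;> (try clear j3) <;> grind
  have j3 : JoinedIn (S) (G (min s u) (min t v)) (G 0 (min t v)) := by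
    refine joined_aux (fun a => G a _) (c1 _) _ 0 fun x hx hx' => hG _ _ ?_ ?_ ?_ ?_ ?_ <;> clear hG c1 c2 <;> (try clear j1) <;> (try clear j2) <;> (try clear j3) <;> grind
  have j4 : JoinedIn (S) (G 0 (min t v)) (G 0 u) := by
    refine joined_aux (fun b => G _ b) (c2 _) _ _ fun x hx hx' => hG _ _ ?_ ?_ ?_ ?_ ?_ <;> clear hG c1 c2 <;> (try clear j1) <;> (try clear j2) <;> (try clear j3) <;> grind
  exact ((j1.trans j2).trans j3).trans j4

/-- Claim 1: if `z = ((p,s),(q,t)) ∈ K` and `s ≤ t`, then there is a subcontinuum `A` of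
`(C×[0,1])²` with `A ⊆ K`, `z ∈ A` and `((p,0),(q,1/2)) ∈ A`. -/
theorem claim1_subcontinuum_to_M
    (f : CantorT ≃ₜ CantorT) (δ : ℝ) (hδ : 0 < δ) (hδ' : δ < 1/10)
    (z : CI × CI) (hz : z ∈ Kset ⇑f δ) (hst : (z.1.2 : ℝ) ≤ (z.2.2 : ℝ)) :
    ∃ A : Set (CI × CI), IsCompact A ∧ IsConnected A ∧ A ⊆ Kset ⇑f δ ∧ z ∈ A ∧
      ((z.1.1, (⟨0, by norm_num⟩ : UnitI)), (z.2.1, (⟨1/2, by norm_num⟩ : UnitI))) ∈ A := by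
  obtain ⟨⟨p, s, hs⟩, ⟨q, t, ht⟩⟩ := z
  simp only at hst
  simp only [Kset, V0, V1, V2, V3, mem_compl_iff, mem_union, mem_ofPred_eq, not_or, not_and,
    not_lt] at hz
  obtain ⟨⟨h1, h2⟩, -⟩ := hz
  have h1' : |(p:ℝ) - q| < δ → δ ≤ t - s := fun h => by
    have := h1 h
    rwa [abs_of_nonneg (by linarith)] at this
  let G : ℝ → ℝ → CI × CI := fun a b =>
    ((p, projIcc 0 1 zero_le_one a), (q, projIcc 0 1 zero_le_one b))
  have hG : ∀ a b, 0 ≤ a → a ≤ b → b ≤ 1 → (|(p:ℝ) - q| < δ → δ ≤ b - a) →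
      (|(p:ℝ) - (f q : ℝ)| < δ → a < δ → b ≤ 1 - δ) → G a b ∈ Kset ⇑f δ := by
    intro a b ha hab hb k1 k2
    simp only [G, Kset, V0, V1, V2, V3, mem_compl_iff, mem_union, mem_ofPred_eq, not_or, not_and,
      not_lt]
    rw [projIcc_of_mem zero_le_one ⟨ha, hab.trans hb⟩, projIcc_of_mem zero_le_one ⟨ha.trans hab, hb⟩]
    refine ⟨⟨fun h => (k1 h).trans (le_abs_self _), k2⟩, fun _ h => ?_⟩
    simp only at h ⊢
    linarith
  have c1 : ∀ b, Continuous fun a => G a b := fun b => by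
    have := continuous_projIcc (a := (0:ℝ)) (b := 1) (h := zero_le_one)
    simp only [G]; fun_prop
  have c2 : ∀ a, Continuous fun b => G a b := fun a => by
    have := continuous_projIcc (a := (0:ℝ)) (b := 1) (h := zero_le_one)
    simp only [G]; fun_prop
  obtain ⟨hs0, hs1⟩ := hs
  obtain ⟨ht0, ht1⟩ := ht
  obtain ⟨γ, hγ⟩ := joined_main (|(p:ℝ) - q| < δ) (|(p:ℝ) - (f q : ℝ)| < δ) G δ hδ (by linarith) (1/2) (4/5)
    (by norm_num) (by norm_num) s t
    hs0 hst ht1 h1' h2 c1 c2 hG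
  refine ⟨range γ, isCompact_range γ.continuous, isConnected_range γ.continuous,
    range_subset_iff.2 hγ, ⟨0, ?_⟩, ⟨1, ?_⟩⟩
  · rw [γ.source]
    simp only [G]
    rw [projIcc_of_mem zero_le_one ⟨hs0, hs1⟩, projIcc_of_mem zero_le_one ⟨ht0, ht1⟩]
  · rw [γ.target]
    simp only [G]
    rw [projIcc_of_mem zero_le_one (by norm_num : (0:ℝ) ∈ Icc (0:ℝ) 1),
      projIcc_of_mem zero_le_one (by norm_num : (1/2:ℝ) ∈ Icc (0:ℝ) 1)]
end
end

section
/- Let f : C → C be a homeomorphism of the Cantor ternary set and fix δ with 0 < δ < 1/10. Define V₁ = {((p,s),(q,t)) ∈ (C×[0,1])² : |p−q| < δ and |t−s| < δ}, V₂ = {((p,s),(q,t)) ∈ (C×[0,1])² : |p−f(q)| < δ, s < δ and 1−δ < t}, V₃ = {((p,s),(q,t)) ∈ (C×[0,1])² : |f(p)−q| < δ, t < δ and 1−δ < s}, V₀ = V₁ ∪ V₂ ∪ V₃, and K = (C×[0,1])² \ V₀. If z = ((p,s),(q,t)) ∈ K and t ≤ s, then there exists a nonempty compact connected subset A of (C×[0,1])²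 with A ⊆ K such that z ∈ A and ((p,1/2),(q,0)) ∈ A. -/
open Set

noncomputable section

/-- The `(s,t)`-slice of `K` over `(p,q)`. -/
def Sl (a b : Prop) (δ : ℝ) : Set (ℝ × ℝ) :=
  {x | 0 ≤ x.1 ∧ x.1 ≤ 1 ∧ 0 ≤ x.2 ∧ x.2 ≤ 1 ∧ (a → δ ≤ x.1 - x.2) ∧
    (δ ≤ x.1 ∨ x.2 ≤ 1 - δ) ∧ (b → δ ≤ x.2 ∨ x.1 ≤ 1 - δ)}

theorem seg_sub (a b : Prop) (δ : ℝ) (x y : ℝ × ℝ)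
    (h : ∀ u v : ℝ, 0 ≤ u → 0 ≤ v → u + v = 1 →
      (u * x.1 + v * y.1, u * x.2 + v * y.2) ∈ Sl a b δ) : JoinedIn (Sl a b δ) x y := by
  apply JoinedIn.of_segment_subset
  rintro _ ⟨u, v, hu, hv, huv, rfl⟩
  exact h u v hu hv huv

theorem joined_slice (a b : Prop) (δ : ℝ) (hδ : 0 < δ) (hδ' : δ < 1/10) (s t : ℝ)
    (h0 : 0 ≤ t) (hts : t ≤ s) (h1 : s ≤ 1) (ha : a → δ ≤ s - t)
    (hb : b → δ ≤ t ∨ s ≤ 1 - δ) : JoinedIn (Sl a b δ) (s, t) (1/2, 0) := by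
  have m1 := min_le_left t δ
  have m2 := min_le_right t δ
  have m3 : 0 ≤ min t δ := le_min h0 hδ.le
  have n1 := min_le_left s (1/2)
  have n2 := min_le_right s (1/2)
  have n3 : 0 ≤ min s (1/2) := le_min (h0.trans hts) (by norm_num)
  have hm : b → δ ≤ min t δ ∨ s ≤ 1 - δ := fun hb' => (hb hb').imp (fun h => le_min h le_rfl) id
  have hn : a → δ ≤ min s (1/2) - min t δ := by
    intro h
    have := ha h
    rcases min_choice s (1/2) with e | e <;> rw [e] <;> linarith
  generalize min t δ = t' at *
  generalize min s (1/2) = s' at *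
  have J1 : JoinedIn (Sl a b δ) (s, t) (s, t') := by
    apply seg_sub
    intro u v hu hv huv
    have e1 : u * s + v * s = s := by rw [← add_mul, huv, one_mul]
    obtain rfl : u = 1 - v := by linarith
    have A1 : (1 - v) * t + v * t' ≤ t := by nlinarith
    have A2 : t' ≤ (1 - v) * t + v * t' := by nlinarith
    simp only [Sl, mem_setOf_eq, e1]
    refine ⟨by linarith, h1, by linarith, by linarith, fun h => ?_, ?_, fun h => ?_⟩
    · linarith [ha h]
    · by_cases h : δ ≤ s
      · exact Or.inl h
      · right; push Not at h; linarith
    · exact (hm h).imp (fun h => by linarith) id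
  have J2 : JoinedIn (Sl a b δ) (s, t') (s', t') := by
    apply seg_sub
    intro u v hu hv huv
    have e1 : u * t' + v * t' = t' := by rw [← add_mul, huv, one_mul]
    obtain rfl : u = 1 - v := by linarith
    have A1 : (1 - v) * s + v * s' ≤ s := by nlinarith
    have A2 : s' ≤ (1 - v) * s + v * s' := by nlinarith
    simp only [Sl, mem_setOf_eq, e1]
    refine ⟨by linarith, by linarith, by linarith, by linarith, fun h => ?_, ?_, fun h => ?_⟩
    · linarith [hn h]
    · right; linarith
    · exact (hm h).imp id (fun h => by linarith)
  have J3 : JoinedIn (Sl a b δ) (s', t') (1/2, 0) := by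
    apply seg_sub
    intro u v hu hv huv
    obtain rfl : u = 1 - v := by linarith
    have A1 : (1 - v) * s' + v * (1/2) ≤ 1/2 := by nlinarith
    have A2 : s' ≤ (1 - v) * s' + v * (1/2) := by nlinarith
    have A3 : 0 ≤ (1 - v) * t' + v * 0 := by nlinarith
    have A4 : (1 - v) * t' + v * 0 ≤ t' := by nlinarith
    simp only [Sl, mem_setOf_eq]
    refine ⟨by linarith, by linarith, by linarith, by linarith, fun h => ?_, ?_, fun h => ?_⟩
    · linarith [hn h]
    · right; linarith
    · right; linarith
  exact (J1.trans J2).trans J3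

/-- Claim 2: if `z = ((p,s),(q,t)) ∈ K` and `t ≤ s`, then there is a subcontinuum `A` of
`(C×[0,1])²` with `A ⊆ K`, `z ∈ A` and `((p,1/2),(q,0)) ∈ A`. -/
theorem claim2_subcontinuum_to_M
    (f : CantorT ≃ₜ CantorT) (δ : ℝ) (hδ : 0 < δ) (hδ' : δ < 1/10)
    (z : CI × CI) (hz : z ∈ Kset ⇑f δ) (hts : (z.2.2 : ℝ) ≤ (z.1.2 : ℝ)) :
    ∃ A : Set (CI × CI), IsCompact A ∧ IsConnected A ∧ A ⊆ Kset ⇑f δ ∧ z ∈ A ∧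
      ((z.1.1, (⟨1/2, by norm_num⟩ : UnitI)), (z.2.1, (⟨0, by norm_num⟩ : UnitI))) ∈ A := by
  obtain ⟨⟨p, ⟨s, hs0, hs1⟩⟩, ⟨q, ⟨t, ht0, ht1⟩⟩⟩ := z
  simp only [Kset, V0, V1, V2, V3, mem_compl_iff, mem_union, mem_setOf_eq, not_or, not_and,
    not_lt] at hz hts ⊢
  obtain ⟨⟨z1, z2⟩, z3⟩ := hz
  obtain ⟨γ, hγ⟩ := joined_slice (|(p : ℝ) - q| < δ) (|(f p : ℝ) - q| < δ) δ hδ hδ' s t ht0 hts hs1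
    (fun h => by
      have := z1 h
      rwa [abs_sub_comm, abs_of_nonneg (by linarith)] at this)
    (fun h => by
      by_cases h' : δ ≤ t
      · exact Or.inl h'
      · exact Or.inr (z3 h (not_le.mp h')))
  let g : ℝ × ℝ → CI × CI := fun x =>
    ((p, projIcc 0 1 zero_le_one x.1), (q, projIcc 0 1 zero_le_one x.2))
  have hg : Continuous g := by
    have := continuous_projIcc (a := (0:ℝ)) (b := 1) (h := zero_le_one)
    fun_prop
  refine ⟨range (g ∘ γ), isCompact_range (hg.comp γ.continuous),
    isConnected_range (hg.comp γ.continuous), ?_, ⟨0, ?_⟩, ⟨1, ?_⟩⟩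
  · rintro _ ⟨u, rfl⟩
    obtain ⟨a1, a2, a3, a4, a5, a6, a7⟩ := hγ u
    have e1 := projIcc_of_mem zero_le_one (show (γ u).1 ∈ Icc (0:ℝ) 1 from ⟨a1, a2⟩)
    have e2 := projIcc_of_mem zero_le_one (show (γ u).2 ∈ Icc (0:ℝ) 1 from ⟨a3, a4⟩)
    simp only [Kset, V0, V1, V2, V3, mem_compl_iff, mem_union, mem_setOf_eq, not_or, not_and,
      not_lt, Function.comp, g, e1, e2]
    refine ⟨⟨fun h => ?_, fun _ h => ?_⟩, fun h h' => ?_⟩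
    · rw [abs_sub_comm]
      exact (a5 h).trans (le_abs_self _)
    · exact a6.resolve_left (not_le.mpr h)
    · exact (a7 h).resolve_left (not_le.mpr h')
  · simp only [Function.comp, γ.source, g]
    rw [projIcc_of_mem zero_le_one (show s ∈ Icc (0:ℝ) 1 from ⟨hs0, hs1⟩),
      projIcc_of_mem zero_le_one (show t ∈ Icc (0:ℝ) 1 from ⟨ht0, ht1⟩)]
  · simp only [Function.comp, γ.target, g]
    rw [projIcc_of_mem zero_le_one (show (1/2:ℝ) ∈ Icc (0:ℝ) 1 by norm_num),
      projIcc_of_mem zero_le_one (show (0:ℝ) ∈ Icc (0:ℝ) 1 by norm_num)]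
end
end

section
/- Let f : C → C be a homeomorphism of the Cantor ternary set, let X be the quotient space obtained from C × [0,1] by identifying, for each p ∈ C, the point (p,1) with (f(p),0), let φ : C×[0,1] → X be the quotient map and σ = φ × φ. Fix δ with 0 < δ < 1/10. Define V₁ = {((p,s),(q,t)) ∈ (C×[0,1])² : |p−q| < δ and |t−s| < δ}, V₂ = {((p,s),(q,t)) ∈ (C×[0,1])² : |p−f(q)| < δ, s < δ and 1−δ < t}, V₃ = {((p,s),(q,t)) ∈ (C×[0,1])² : |f(p)−q| < δ, t < δ and 1−δ < s}, V₀ = V₁ ∪ V₂ ∪ V₃, K = (C×[0,1])² \ V₀, and M = (C×{0}) × (C×{1/2}). Then for every z ∈ K there exists a nonempty compact connected subset B of X² with B ⊆ σ(K) such that σ(z) ∈ B and B ∩ σ(M) ≠ ∅. -/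
open Set

noncomputable section

/-- The quotient map `φ : C × [0,1] → X`. -/
def glueMap (f : CantorT → CantorT) : CI → GlueSpace f := Quot.mk (glueRel f)

/-- The map `σ = φ × φ : (C × [0,1])² → X²`. -/
def sigmaMap (f : CantorT → CantorT) : CI × CI → GlueSpace f × GlueSpace f :=
  Prod.map (glueMap f) (glueMap f)


def hMap (p q : CantorT) (x : ℝ × ℝ) : CI × CI :=
  ((p, projIcc 0 1 zero_le_one x.1), (q, projIcc 0 1 zero_le_one x.2))

lemma hMap_cont (p q : CantorT) : Continuous (hMap p q) := by
  unfold hMap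
  have h : Continuous (projIcc (0:ℝ) 1 zero_le_one) := continuous_projIcc
  fun_prop

lemma sigma_cont (f : CantorT → CantorT) : Continuous (sigmaMap f) := by
  have h : Continuous (glueMap f) := continuous_quot_mk
  exact h.prodMap h

lemma hMap_coe (p q : CantorT) (s t : UnitI) : hMap p q ((s:ℝ), (t:ℝ)) = ((p, s), (q, t)) := by
  simp [hMap]

lemma seg_compact (a b : ℝ × ℝ) : IsCompact (segment ℝ a b) := by
  rw [segment_eq_image]
  exact isCompact_Icc.image (by fun_prop)

lemma build (f : CantorT → CantorT) (δ : ℝ) (p q : CantorT) (a c m : ℝ × ℝ)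
    (ha : ∀ u v : ℝ, 0 ≤ u → 0 ≤ v → u + v = 1 → hMap p q (u • a + v • c) ∈ Kset f δ)
    (hc : ∀ u v : ℝ, 0 ≤ u → 0 ≤ v → u + v = 1 → hMap p q (u • c + v • m) ∈ Kset f δ)
    (N : Set (GlueSpace f × GlueSpace f)) (hm : sigmaMap f (hMap p q m) ∈ N) :
    ∃ B : Set (GlueSpace f × GlueSpace f), IsCompact B ∧ IsConnected B ∧
      B ⊆ sigmaMap f '' Kset f δ ∧ sigmaMap f (hMap p q a) ∈ B ∧ (B ∩ N).Nonempty := by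
  have hcont : Continuous (fun x => sigmaMap f (hMap p q x)) :=
    (sigma_cont f).comp (hMap_cont p q)
  refine ⟨(fun x => sigmaMap f (hMap p q x)) '' (segment ℝ a c ∪ segment ℝ c m),
    ((seg_compact a c).union (seg_compact c m)).image hcont, ?_, ?_, ?_, ?_⟩
  · refine IsConnected.image ?_ _ hcont.continuousOn
    refine IsConnected.union ⟨c, right_mem_segment ℝ a c, left_mem_segment ℝ c m⟩ ?_ ?_
    · exact ⟨⟨c, right_mem_segment ℝ a c⟩, (convex_segment a c).isPreconnected⟩
    · exact ⟨⟨c, left_mem_segment ℝ c m⟩, (convex_segment c m).isPreconnected⟩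
  · rintro _ ⟨x, hx | hx, rfl⟩
    · obtain ⟨u, v, hu, hv, huv, rfl⟩ := hx
      exact ⟨_, ha u v hu hv huv, rfl⟩
    · obtain ⟨u, v, hu, hv, huv, rfl⟩ := hx
      exact ⟨_, hc u v hu hv huv, rfl⟩
  · exact ⟨a, Or.inl (left_mem_segment ℝ a c), rfl⟩
  · exact ⟨_, ⟨m, Or.inr (right_mem_segment ℝ c m), rfl⟩, hm⟩

lemma memK (f : CantorT → CantorT) (δ : ℝ) (p q : CantorT) (s t : ℝ)
    (hs : 0 ≤ s) (hs' : s ≤ 1) (ht : 0 ≤ t) (ht' : t ≤ 1) :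
    hMap p q (s, t) ∈ Kset f δ ↔
      ((δ ≤ |(p:ℝ) - q| ∨ δ ≤ |t - s|) ∧ (δ ≤ |(p:ℝ) - f q| ∨ δ ≤ s ∨ t ≤ 1 - δ)) ∧
      (δ ≤ |(f p:ℝ) - q| ∨ δ ≤ t ∨ s ≤ 1 - δ) := by
  have e : hMap p q (s, t) = ((p, ⟨s, hs, hs'⟩), (q, ⟨t, ht, ht'⟩)) := hMap_coe p q ⟨s, hs, hs'⟩ ⟨t, ht, ht'⟩
  rw [e]
  simp only [Kset, V0, V1, V2, V3, mem_compl_iff, mem_union, mem_ofPred_eq, not_or, not_and_or, not_lt]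

/-- Claim 3: with `M = (C×{0}) × (C×{1/2})`, for every `z ∈ K` there is a subcontinuum `B`
of `X²` with `B ⊆ σ(K)`, `σ(z) ∈ B` and `B ∩ σ(M) ≠ ∅`. -/
theorem claim3_subcontinuum_meets_sigmaM
    (f : CantorT ≃ₜ CantorT) (δ : ℝ) (hδ : 0 < δ) (hδ' : δ < 1/10)
    (z : CI × CI) (hz : z ∈ Kset ⇑f δ) :
    ∃ B : Set (GlueSpace ⇑f × GlueSpace ⇑f), IsCompact B ∧ IsConnected B ∧
      B ⊆ sigmaMap ⇑f '' Kset ⇑f δ ∧ sigmaMap ⇑f z ∈ B ∧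
      (B ∩ sigmaMap ⇑f '' {w : CI × CI | (w.1.2 : ℝ) = 0 ∧ (w.2.2 : ℝ) = 1/2}).Nonempty := by
  obtain ⟨⟨p, s⟩, ⟨q, t⟩⟩ := z
  obtain ⟨s, hs, hs'⟩ := s
  obtain ⟨t, ht, ht'⟩ := t
  have e : hMap p q (s, t) = ((p, ⟨s, hs, hs'⟩), (q, ⟨t, ht, ht'⟩)) :=
    hMap_coe p q ⟨s, hs, hs'⟩ ⟨t, ht, ht'⟩
  rw [← e] at hz ⊢
  obtain ⟨⟨h1, h2⟩, h3⟩ := (memK f δ p q s t hs hs' ht ht').1 hz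
  rcases le_total s t with hst | hst
  · rw [abs_of_nonneg (sub_nonneg.2 hst)] at h1
    refine build f δ p q (s, t) (δ, 1 - δ) (0, 1/2) ?_ ?_ _ ?_
    · intro u v hu hv huv
      obtain rfl : v = 1 - u := by linarith
      simp only [Prod.smul_mk, Prod.mk_add_mk, smul_eq_mul]
      refine (memK f δ p q _ _ ?_ ?_ ?_ ?_).2 ⟨⟨?_, ?_⟩, ?_⟩
      · nlinarith
      · nlinarith
      · nlinarith
      · nlinarith
      · refine h1.imp id fun h => le_trans ?_ (le_abs_self _)
        nlinarith
      · refine h2.imp id (Or.imp (fun h => ?_) (fun h => ?_)) <;> nlinarith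
      · right
        by_cases hh : u * t + (1 - u) * (1 - δ) < δ
        · right; nlinarith
        · left; linarith
    · intro u v hu hv huv
      obtain rfl : v = 1 - u := by linarith
      simp only [Prod.smul_mk, Prod.mk_add_mk, smul_eq_mul]
      refine (memK f δ p q _ _ ?_ ?_ ?_ ?_).2
        ⟨⟨Or.inr (le_trans ?_ (le_abs_self _)), Or.inr (Or.inr ?_)⟩, Or.inr (Or.inl ?_)⟩ <;> nlinarith
    · refine ⟨_, ⟨?_, ?_⟩, rfl⟩
      · simp [hMap]
      · simp only [hMap]
        rw [projIcc_of_mem zero_le_one (show (1/2:ℝ) ∈ Icc (0:ℝ) 1 by norm_num)]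
  · rw [abs_sub_comm t s, abs_of_nonneg (sub_nonneg.2 hst)] at h1
    refine build f δ p q (s, t) (1 - δ, δ) (1, 1/2) ?_ ?_ _ ?_
    · intro u v hu hv huv
      obtain rfl : v = 1 - u := by linarith
      simp only [Prod.smul_mk, Prod.mk_add_mk, smul_eq_mul]
      refine (memK f δ p q _ _ ?_ ?_ ?_ ?_).2 ⟨⟨?_, ?_⟩, ?_⟩
      · nlinarith
      · nlinarith
      · nlinarith
      · nlinarith
      · refine h1.imp id fun h => le_trans ?_ (neg_le_abs _)
        nlinarith
      · right
        by_cases hh : u * s + (1 - u) * (1 - δ) < δ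
        · right; nlinarith
        · left; linarith
      · refine h3.imp id (Or.imp (fun h => ?_) (fun h => ?_)) <;> nlinarith
    · intro u v hu hv huv
      obtain rfl : v = 1 - u := by linarith
      simp only [Prod.smul_mk, Prod.mk_add_mk, smul_eq_mul]
      refine (memK f δ p q _ _ ?_ ?_ ?_ ?_).2
        ⟨⟨Or.inr (le_trans ?_ (neg_le_abs _)), Or.inr (Or.inl ?_)⟩, Or.inr (Or.inl ?_)⟩ <;> nlinarith
    · refine ⟨hMap (f p) q (0, 1/2), ⟨?_, ?_⟩, ?_⟩
      · simp [hMap]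
      · simp only [hMap]
        rw [projIcc_of_mem zero_le_one (show (1/2:ℝ) ∈ Icc (0:ℝ) 1 by norm_num)]
      · refine Prod.ext (Eq.symm (Quot.sound ?_)) rfl
        refine ⟨?_, rfl, ?_⟩ <;> simp [hMap]
end
end

section
/- Let X be the sin(1/x)-curve, i.e., the closure in ℝ² of the set {(x, sin(1/x)) : x ∈ (0,1]} (so X equals this graph together with {0} × [−1,1]). Then X is a decomposable continuum and X² \ Δ is not continuumwise connected in X². -/
open Set

noncomputable section

/-- The `sin(1/x)`-curve: the closure in `ℝ²` of `{(x, sin(1/x)) : x ∈ (0,1]}`. -/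
def sinCurve : Set (ℝ × ℝ) :=
  closure ((fun x : ℝ => (x, Real.sin x⁻¹)) '' Set.Ioc 0 1)

theorem aux_cont : ContinuousOn (fun x : ℝ => (x, Real.sin x⁻¹)) (Set.Ioi 0) := by
  apply ContinuousOn.prodMk continuousOn_id
  apply Real.continuous_sin.comp_continuousOn
  exact continuousOn_inv₀.mono (fun x hx => ne_of_gt hx)

theorem aux_box {p : ℝ × ℝ} (hp : p ∈ sinCurve) :
    0 ≤ p.1 ∧ p.1 ≤ 1 ∧ -1 ≤ p.2 ∧ p.2 ≤ 1 := by
  have h : sinCurve ⊆ Set.Icc ((0:ℝ), (-1:ℝ)) (1, 1) := by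
    apply closure_minimal _ isClosed_Icc
    rintro _ ⟨x, hx, rfl⟩
    exact ⟨⟨hx.1.le, Real.neg_one_le_sin _⟩, ⟨hx.2, Real.sin_le_one _⟩⟩
  obtain ⟨⟨a, b⟩, ⟨c, d⟩⟩ := h hp
  exact ⟨a, c, b, d⟩

theorem aux_graph {p : ℝ × ℝ} (hp : p ∈ sinCurve) (h0 : 0 < p.1) :
    p.2 = Real.sin p.1⁻¹ := by
  obtain ⟨u, hu, hlim⟩ := mem_closure_iff_seq_limit.1 hp
  have h1 := (continuous_fst.tendsto p).comp hlim
  have h2 := (continuous_snd.tendsto p).comp hlim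
  have h3 : Filter.Tendsto (fun n => Real.sin (u n).1⁻¹) Filter.atTop
      (nhds (Real.sin p.1⁻¹)) :=
    (Real.continuous_sin.tendsto _).comp (h1.inv₀ h0.ne')
  refine tendsto_nhds_unique h2 (h3.congr ?_)
  intro n
  obtain ⟨x, hx, hxu⟩ := hu n
  simp [← hxu]

theorem aux_mem {x : ℝ} (h0 : 0 < x) (h1 : x ≤ 1) : (x, Real.sin x⁻¹) ∈ sinCurve :=
  subset_closure ⟨x, ⟨h0, h1⟩, rfl⟩

theorem aux_compact : IsCompact sinCurve := by
  apply (isCompact_Icc (a := ((0:ℝ), (-1:ℝ))) (b := (1, 1))).of_isClosed_subset isClosed_closure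
  intro p hp
  obtain ⟨a, c, b, d⟩ := aux_box hp
  exact ⟨⟨a, b⟩, ⟨c, d⟩⟩

theorem aux_conn (a : ℝ) (ha : 0 < a) :
    IsConnected (closure ((fun x : ℝ => (x, Real.sin x⁻¹)) '' Set.Ioc 0 a)) := by
  apply IsConnected.closure
  exact (isConnected_Ioc ha).image _ (aux_cont.mono (fun x hx => hx.1))

theorem aux_pre {S : Set (ℝ × ℝ)} (hS : S ⊆ sinCurve) (h1 : IsCompact S) (h2 : IsConnected S) :
    IsCompact (Subtype.val ⁻¹' S : Set ↥sinCurve) ∧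
      IsConnected (Subtype.val ⁻¹' S : Set ↥sinCurve) := by
  have e : Subtype.val '' (Subtype.val ⁻¹' S : Set ↥sinCurve) = S := by
    rw [Subtype.image_preimage_coe]; exact inter_eq_right.2 hS
  refine ⟨?_, ?_, ?_⟩
  · rw [Topology.IsInducing.subtypeVal.isCompact_iff, e]; exact h1
  · obtain ⟨x, hx⟩ := h2.1
    exact ⟨⟨x, hS hx⟩, hx⟩
  · rw [← Topology.IsInducing.subtypeVal.isPreconnected_image, e]; exact h2.2

theorem aux_notcc : ¬ ContinuumwiseConnected {w : ↥sinCurve × ↥sinCurve | w.1 ≠ w.2} := by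
  intro H
  let P : ↥sinCurve := ⟨_, aux_mem one_pos le_rfl⟩
  let Q : ↥sinCurve := ⟨_, aux_mem (x := 1/2) (by norm_num) (by norm_num)⟩
  have hPQ : P ≠ Q := by
    intro h
    have := congrArg (fun z : ↥sinCurve => z.1.1) h
    norm_num [P, Q] at this
  obtain ⟨M, hMc, hMconn, hp, hq, hM⟩ := H (P, Q) hPQ (Q, P) hPQ.symm
  have c1 : Continuous (fun w : ↥sinCurve × ↥sinCurve => w.1.1.1) := by fun_prop
  have c2 : Continuous (fun w : ↥sinCurve × ↥sinCurve => w.1.1.2) := by fun_prop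
  have c3 : Continuous (fun w : ↥sinCurve × ↥sinCurve => w.2.1.1) := by fun_prop
  have c4 : Continuous (fun w : ↥sinCurve × ↥sinCurve => w.2.1.2) := by fun_prop
  have hd : ∃ d : ℝ, 0 < d ∧ ∀ w ∈ M, w.2.1.1 ≤ w.1.1.1 → w.1.1.2 = w.2.1.2 → d ≤ w.1.1.1 := by
    have hK : IsCompact (M ∩ ({w | w.2.1.1 ≤ w.1.1.1} ∩ {w | w.1.1.2 = w.2.1.2})) :=
      hMc.inter_right ((isClosed_le c3 c1).inter (isClosed_eq c2 c4))
    rcases Set.eq_empty_or_nonempty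
      (M ∩ ({w | w.2.1.1 ≤ w.1.1.1} ∩ {w | w.1.1.2 = w.2.1.2})) with he | hne
    · refine ⟨1, one_pos, fun w hw h1 h2 => ?_⟩
      have : w ∈ (∅ : Set (↥sinCurve × ↥sinCurve)) := he ▸ ⟨hw, h1, h2⟩
      exact this.elim
    · obtain ⟨w, ⟨hw, h1, h2⟩, hmin⟩ := hK.exists_isMinOn hne c1.continuousOn
      refine ⟨w.1.1.1, ?_, fun v hv h3 h4 => hmin ⟨hv, h3, h4⟩⟩
      by_contra hneg
      have b1 := aux_box w.1.2
      have b2 := aux_box w.2.2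
      simp only [mem_ofPred_eq] at h1 h2
      apply hM hw
      apply Subtype.ext
      apply Prod.ext
      · linarith
      · exact h2
  obtain ⟨d, hd0, hd⟩ := hd
  obtain ⟨k, hk⟩ := exists_nat_gt d⁻¹
  have hpi := Real.pi_gt_three
  have hk0 : (0:ℝ) ≤ k := k.cast_nonneg
  have hkpi : (k:ℝ) * 3 ≤ k * Real.pi := by nlinarith
  set t1 : ℝ := Real.pi / 2 + k * (2 * Real.pi) with ht1
  set t2 : ℝ := -(Real.pi / 2) + (k + 1 : ℕ) * (2 * Real.pi) with ht2
  have s1 : Real.sin t1 = 1 := by rw [ht1, Real.sin_add_nat_mul_two_pi, Real.sin_pi_div_two]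
  have s2 : Real.sin t2 = -1 := by
    rw [ht2, Real.sin_add_nat_mul_two_pi, Real.sin_neg, Real.sin_pi_div_two]
  have t12 : t1 < t2 := by rw [ht1, ht2]; push_cast; linarith
  have t1k : d⁻¹ < t1 := by rw [ht1]; linarith
  have t11 : 1 < t1 := by rw [ht1]; linarith
  have x12 : t2⁻¹ < t1⁻¹ := inv_strictAnti₀ (by linarith) t12
  have x1d : t1⁻¹ < d := inv_lt_of_inv_lt₀ hd0 t1k
  have x11 : t1⁻¹ < 1 := inv_lt_one_of_one_lt₀ t11
  have x20 : 0 < t2⁻¹ := inv_pos.2 (by linarith)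
  have hU : IsOpen ({w : ↥sinCurve × ↥sinCurve | w.2.1.1 < w.1.1.1} ∩
      ({w | t1⁻¹ < w.1.1.1} ∪ ({w | t2⁻¹ < w.1.1.1} ∩ {w | w.2.1.2 < w.1.1.2}))) :=
    (isOpen_lt c3 c1).inter ((isOpen_lt continuous_const c1).union
      ((isOpen_lt continuous_const c1).inter (isOpen_lt c4 c2)))
  have hV : IsOpen ({w : ↥sinCurve × ↥sinCurve | w.1.1.1 < w.2.1.1} ∪
      (({w | w.1.1.1 < t1⁻¹} ∩ {w | w.1.1.2 < w.2.1.2}) ∪ {w | w.1.1.1 < t2⁻¹})) :=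
    (isOpen_lt c1 c3).union (((isOpen_lt c1 continuous_const).inter (isOpen_lt c2 c4)).union
      (isOpen_lt c1 continuous_const))
  refine absurd (hMconn.2 _ _ hU hV ?_ ⟨_, hp, ?_, ?_⟩ ⟨_, hq, ?_⟩) ?_
  · intro w hw
    by_contra hn
    simp only [mem_ofPred_eq, mem_union, mem_inter_iff, not_or, not_and, not_lt] at hn
    obtain ⟨n1, n2, n3, n4⟩ := hn
    have hlt : w.2.1.1 < w.1.1.1 := by
      rcases lt_or_eq_of_le n2 with h | h
      · exact h
      · exfalso
        apply hM hw
        apply Subtype.ext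
        apply Prod.ext
        · exact h.symm
        · rw [aux_graph w.1.2 (by linarith), aux_graph w.2.2 (by linarith), h]
    have b2 := aux_box w.2.2
    obtain ⟨m1, m2⟩ := n1 hlt
    have hne : w.1.1.2 ≠ w.2.1.2 := fun h => by
      have := hd w hw n2 h
      linarith
    have g := aux_graph w.1.2 (by linarith)
    rcases lt_or_eq_of_le m1 with h | h
    · have h5 := n3 h
      rcases lt_or_eq_of_le n4 with h6 | h6
      · exact hne (le_antisymm (m2 h6) h5)
      · rw [← h6, inv_inv, s2] at g
        apply hne; linarith
    · rw [h, inv_inv, s1] at g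
      have := m2 (by linarith)
      apply hne; linarith
  · norm_num [P, Q]
  · left
    simpa [P] using x11
  · left
    norm_num [P, Q]
  · rintro ⟨w, hw, ⟨hu1, hu2⟩, hv⟩
    simp only [mem_ofPred_eq, mem_union, mem_inter_iff] at hu1 hu2 hv
    rcases hu2 with h | ⟨h, h'⟩ <;> rcases hv with g | ⟨g, g'⟩ | g <;> linarith

/-- The `sin(1/x)`-curve `X` is a decomposable continuum (compact, connected,
nondegenerate, and the union of two proper subcontinua) and `X² \ Δ` is not
continuumwise connected in `X²`. -/
theorem sinCurve_decomposable_and_not_continuumwiseConnected :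
    CompactSpace ↥sinCurve ∧ ConnectedSpace ↥sinCurve ∧ Nontrivial ↥sinCurve ∧
    (∃ A B : Set ↥sinCurve, IsCompact A ∧ IsConnected A ∧ IsCompact B ∧ IsConnected B ∧
      A ≠ univ ∧ B ≠ univ ∧ A ∪ B = univ) ∧
    ¬ ContinuumwiseConnected {w : ↥sinCurve × ↥sinCurve | w.1 ≠ w.2} := by
  refine ⟨isCompact_iff_compactSpace.1 aux_compact,
    isConnected_iff_connectedSpace.1 (aux_conn 1 one_pos), ?_, ?_, aux_notcc⟩
  · refine ⟨⟨_, aux_mem one_pos le_rfl⟩,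
      ⟨_, aux_mem (x := 1/2) (by norm_num) (by norm_num)⟩, fun h => ?_⟩
    have := congrArg (fun z : ↥sinCurve => z.1.1) h
    norm_num at this
  · have hA : closure ((fun x : ℝ => (x, Real.sin x⁻¹)) '' Set.Ioc 0 (1/2)) ⊆ sinCurve :=
      closure_mono (image_mono (Ioc_subset_Ioc_right (by norm_num)))
    have hB : (fun x : ℝ => (x, Real.sin x⁻¹)) '' Set.Icc (1/2) 1 ⊆ sinCurve := by
      rintro _ ⟨x, hx, rfl⟩
      exact aux_mem (by linarith [hx.1]) hx.2
    have cB : ContinuousOn (fun x : ℝ => (x, Real.sin x⁻¹)) (Set.Icc (1/2) 1) :=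
      aux_cont.mono (fun x hx => by have := hx.1; simp only [mem_Ioi]; linarith)
    have kB := isCompact_Icc.image_of_continuousOn cB
    obtain ⟨a1, a2⟩ := aux_pre hA (aux_compact.of_isClosed_subset isClosed_closure hA)
      (aux_conn _ (by norm_num))
    obtain ⟨b1, b2⟩ := aux_pre hB kB ((isConnected_Icc (by norm_num)).image _ cB)
    refine ⟨_, _, a1, a2, b1, b2, ?_, ?_, ?_⟩
    · intro h
      have h1 : (⟨_, aux_mem one_pos le_rfl⟩ : ↥sinCurve) ∈ (univ : Set ↥sinCurve) := mem_univ _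
      rw [← h] at h1
      have h2 : closure ((fun x : ℝ => (x, Real.sin x⁻¹)) '' Set.Ioc 0 (1/2)) ⊆
          {p : ℝ × ℝ | p.1 ≤ 1/2} := by
        apply closure_minimal _ (isClosed_le continuous_fst continuous_const)
        rintro _ ⟨x, hx, rfl⟩
        exact hx.2
      have h3 := h2 h1
      norm_num at h3
    · intro h
      have h1 : (⟨_, aux_mem (x := 1/4) (by norm_num) (by norm_num)⟩ : ↥sinCurve) ∈
        (univ : Set ↥sinCurve) := mem_univ _
      rw [← h] at h1
      obtain ⟨x, hx, hxe⟩ := h1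
      have h4 : x = 1/4 := congrArg Prod.fst hxe
      have := hx.1
      rw [h4] at this
      norm_num at this
    · rw [← preimage_union, ← kB.isClosed.closure_eq, ← closure_union, ← image_union]
      apply eq_univ_of_forall
      rintro ⟨p, hp⟩
      refine closure_mono (image_mono ?_) hp
      intro x hx
      rcases le_total x (1/2) with h | h
      · exact Or.inl ⟨hx.1, h⟩
      · exact Or.inr ⟨h, hx.2⟩
end
end
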